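/- arXiv:1801.07034 — 2 statements merged into one kernel-verified Lean document; each statement's English description precedes it below -/
import Mathlib

section
/- Let 3 ≤ a ≤ b and set p := ab + a − 1. Then κ_{p,1} ≤ p · C((a+1)b, p+1) + p, where C denotes the binomial coefficient. -/
open MvPolynomial
open scoped TensorProduct

set_option maxHeartbeats 1600000
set_option synthInstance.maxHeartbeats 400000
set_option maxSynthPendingDepth 3

noncomputable section

/-- The space of bihomogeneous polynomials in `k[x,y,z,w]` of bidegree `(d, e)`:
all monomials `x^α y^β z^γ w^δ` occurring satisfy `α + β = d` and `γ + δ = e`. -/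
def Bihom (k : Type*) [Field k] (d e : ℕ) : Submodule k (MvPolynomial (Fin 4) k) where
  carrier := {f | ∀ m ∈ f.support, m 0 + m 1 = d ∧ m 2 + m 3 = e}
  add_mem' := by
    intro f g hf hg m hm
    rcases Finset.mem_union.mp (MvPolynomial.support_add hm) with h | h
    exacts [hf m h, hg m h]
  zero_mem' := by intro m hm; simp at hm
  smul_mem' := by
    intro c f hf m hm
    exact hf m (MvPolynomial.support_smul hm)

/-- `RS k a b q` is the degree-`q` part `R_q` of the homogeneous coordinate ring of the
Segre–Veronese embedding of `ℙ¹×ℙ¹` by `O(a)⊠O(b)`: bihomogeneous polynomials of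
bidegree `(q*a, q*b)`. -/
abbrev RS (k : Type*) [Field k] (a b q : ℕ) : Submodule k (MvPolynomial (Fin 4) k) :=
  Bihom k (q*a) (q*b)

theorem Bihom.mul_mem' {k : Type*} [Field k] {d e d' e' : ℕ} {f g : MvPolynomial (Fin 4) k}
    (hf : f ∈ Bihom k d e) (hg : g ∈ Bihom k d' e') : f * g ∈ Bihom k (d+d') (e+e') := by
  intro m hm
  have h := MvPolynomial.support_mul f g hm
  rw [Finset.mem_add] at h
  obtain ⟨m1, h1, m2, h2, rfl⟩ := h
  obtain ⟨e1, e2⟩ := hf m1 h1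
  obtain ⟨e3, e4⟩ := hg m2 h2
  constructor <;> simp only [Finsupp.add_apply] <;> omega

/-- Multiplication `R_1 × R_q → R_{q+1}`. -/
def segMul (k : Type*) [Field k] (a b q : ℕ) (v : RS k a b 1) (f : RS k a b q) :
    RS k a b (q+1) := by
  refine ⟨(v : MvPolynomial (Fin 4) k) * (f : MvPolynomial (Fin 4) k), ?_⟩
  have h := Bihom.mul_mem' v.2 f.2
  rwa [show 1*a + q*a = (q+1)*a by ring, show 1*b + q*b = (q+1)*b by ring] at h

/-- The wedge product of a family of vectors, as an element of the `n`-th exterior power. -/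
def wedge (k : Type*) [Field k] {M : Type*} [AddCommGroup M] [Module k M] (n : ℕ)
    (v : Fin n → M) : ⋀[k]^n M :=
  ⟨ExteriorAlgebra.ιMulti k n v, ExteriorAlgebra.ιMulti_range k n (Set.mem_range_self v)⟩

/-- The type of a family of Koszul differentials
`δ_{n+1,q} : Λ^{n+1} V ⊗ R_q → Λ^n V ⊗ R_{q+1}` for the Segre–Veronese ring,
where `V = R_1`. -/
abbrev KoszulMaps (k : Type*) [Field k] (a b : ℕ) :=
  ∀ n q : ℕ, ((⋀[k]^(n+1) (RS k a b 1)) ⊗[k] (RS k a b q)) →ₗ[k]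
      ((⋀[k]^n (RS k a b 1)) ⊗[k] (RS k a b (q+1)))

/-- The defining property of the Koszul differentials:
`δ (v_1∧⋯∧v_p ⊗ f) = Σ_i (−1)^{i+1} v_1∧⋯∧v̂_i∧⋯∧v_p ⊗ v_i·f` (1-indexed signs). -/
def IsKoszul (k : Type*) [Field k] (a b : ℕ) (δ : KoszulMaps k a b) : Prop :=
  ∀ (n q : ℕ) (v : Fin (n+1) → RS k a b 1) (f : RS k a b q),
    δ n q (wedge k (n+1) v ⊗ₜ[k] f) =
      ∑ i : Fin (n+1), ((-1:k)^(i:ℕ)) •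
        (wedge k n (fun j => v (i.succAbove j)) ⊗ₜ[k] segMul k a b q (v i) f)

/-- `Kp1 k a b δ n` is the Koszul cohomology `K_{p,1}` for `p = n+1`:
`ker δ_{p,1} / im δ_{p+1,0}`. -/
abbrev Kp1 (k : Type*) [Field k] (a b : ℕ) (δ : KoszulMaps k a b) (n : ℕ) :=
  LinearMap.ker (δ n 1) ⧸
    Submodule.comap (LinearMap.ker (δ n 1)).subtype (LinearMap.range (δ (n+1) 0))

/-- Laurent polynomials in two variables, graded by `ℤ × ℤ`. -/
abbrev Lau (k : Type*) [Field k] := AddMonoidAlgebra k (ℤ × ℤ)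

section Laurent

variable {k : Type*} [Field k]

variable (k) in
/-- The Laurent monomial with exponent `d`. -/
def mon (d : ℤ × ℤ) : Lau k := AddMonoidAlgebra.single d 1

theorem mon_mul_coeff (d e : ℤ × ℤ) (f : Lau k) : (mon k d * f).coeff e = f.coeff (e - d) := by
  rw [mon, AddMonoidAlgebra.coeff_single_mul_apply, one_mul, neg_add_eq_sub]

theorem mon_coeff (d e : ℤ × ℤ) : (mon k d : Lau k).coeff e = if d = e then 1 else 0 := by
  classical
  rw [mon, AddMonoidAlgebra.coeff_single, Finsupp.single_apply]

theorem mon_mul_mon (d e : ℤ × ℤ) : (mon k d * mon k e : Lau k) = mon k (d + e) := by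
  simp [mon, AddMonoidAlgebra.single_mul_single]

theorem mon_zero : (mon k 0 : Lau k) = 1 := rfl

/-- Laurent polynomials all of whose exponents `d` satisfy `ℓ d ≤ m`. -/
def DegLE (ℓ : ℤ × ℤ →+ ℤ) (m : ℤ) : Submodule k (Lau k) where
  carrier := {f | ∀ d, m < ℓ d → f.coeff d = 0}
  add_mem' := by
    intro f g hf hg d hd
    simp [hf d hd, hg d hd]
  zero_mem' := by intro d _; simp
  smul_mem' := by
    intro c f hf d hd
    simp [hf d hd]

variable {ℓ : ℤ × ℤ →+ ℤ} {m m' : ℤ} {f g : Lau k}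

theorem DegLE.mono (h : m ≤ m') (hf : f ∈ DegLE ℓ m) : f ∈ DegLE ℓ m' :=
  fun d hd => hf d (h.trans_lt hd)

theorem DegLE.mul (hf : f ∈ DegLE ℓ m) (hg : g ∈ DegLE ℓ m') : f * g ∈ DegLE ℓ (m + m') := by
  classical
  intro d hd
  rw [AddMonoidAlgebra.coeff_mul_apply_left]
  refine Finset.sum_eq_zero fun e _ => ?_
  show f.coeff e * g.coeff (-e + d) = 0
  by_cases he : m < ℓ e
  · rw [hf e he, zero_mul]
  · rw [hg _ (by rw [map_add, map_neg]; omega), mul_zero]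

theorem DegLE.mon_mem {d : ℤ × ℤ} (h : ℓ d ≤ m) : (mon k d : Lau k) ∈ DegLE ℓ m := by
  intro e he
  rw [mon_coeff, if_neg]
  rintro rfl
  omega

theorem DegLE.one_mem (h : 0 ≤ m) : (1 : Lau k) ∈ DegLE ℓ m :=
  mon_zero (k := k) ▸ DegLE.mon_mem (by simpa using h)

theorem DegLE.prod {σ : Type*} (s : Finset σ) (F : σ → Lau k) (w : σ → ℤ)
    (h : ∀ i ∈ s, F i ∈ DegLE ℓ (w i)) : ∏ i ∈ s, F i ∈ DegLE ℓ (∑ i ∈ s, w i) := by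
  classical
  induction s using Finset.induction_on with
  | empty => simpa using DegLE.one_mem le_rfl
  | insert i s hi ih =>
    rw [Finset.prod_insert hi, Finset.sum_insert hi]
    exact DegLE.mul (h i (Finset.mem_insert_self i s))
      (ih fun j hj => h j (Finset.mem_insert_of_mem hj))

end Laurent

/-- The lattice points of the rectangle `[0,a] × [0,b]`. -/
abbrev Grid (a b : ℕ) := Fin (a + 1) × Fin (b + 1)

/-- Vectors indexed by the lattice points, with Laurent polynomial entries. -/
abbrev Vec (k : Type*) [Field k] (a b : ℕ) := Grid a b → Lau k

/-- Alternating `n`-forms on `Vec`. -/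
abbrev LauForm (k : Type*) [Field k] (a b n : ℕ) := Vec k a b [⋀^Fin n]→ₗ[Lau k] Lau k

section Forms

variable {k : Type*} [Field k] {a b n : ℕ}

/-- Combinations of a family `B` whose coefficient at `B q` has degree at most `w q`. -/
def WSpan (B : Grid a b → Vec k a b) (ℓ : ℤ × ℤ →+ ℤ) (w : Grid a b → ℤ) :
    Submodule k (Vec k a b) where
  carrier := {v | ∃ t : Grid a b → Lau k, (∀ q, t q ∈ DegLE ℓ (w q)) ∧ v = ∑ q, t q • B q}
  add_mem' := by
    rintro _ _ ⟨t, ht, rfl⟩ ⟨t', ht', rfl⟩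
    exact ⟨t + t', fun q => add_mem (ht q) (ht' q), by
      simp only [Pi.add_apply, add_smul, Finset.sum_add_distrib]⟩
  zero_mem' := ⟨0, fun q => zero_mem _, by simp⟩
  smul_mem' := by
    rintro c _ ⟨t, ht, rfl⟩
    exact ⟨c • t, fun q => Submodule.smul_mem _ _ (ht q), by
      simp only [Pi.smul_apply, smul_assoc, Finset.smul_sum]⟩

variable {B : Grid a b → Vec k a b} {ℓ : ℤ × ℤ →+ ℤ} {w : Grid a b → ℤ}

theorem WSpan.smul_mem {c : Lau k} {q : Grid a b} (h : c ∈ DegLE ℓ (w q)) :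
    c • B q ∈ WSpan B ℓ w := by
  classical
  refine ⟨Pi.single q c, fun q' => ?_, ?_⟩
  · by_cases hq : q' = q
    · subst hq; simpa using h
    · simp [hq]
  · rw [Finset.sum_eq_single q] <;> simp +contextual

theorem WSpan.mem_self {q : Grid a b} (h : 0 ≤ w q) : B q ∈ WSpan B ℓ w := by
  simpa using WSpan.smul_mem (B := B) (DegLE.one_mem (k := k) (ℓ := ℓ) h)

theorem WSpan.le_span {v : Vec k a b} (h : v ∈ WSpan B ℓ w) :
    v ∈ Submodule.span (Lau k) (Set.range B) := by
  obtain ⟨t, -, rfl⟩ := h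
  exact Submodule.sum_mem _ fun q _ =>
    Submodule.smul_mem _ _ (Submodule.subset_span (Set.mem_range_self q))

theorem LauForm.apply_mem_degLE (ω : LauForm k a b n) {m : ℤ} (e : Fin n → ℤ)
    (v : Fin n → Vec k a b) (hv : ∀ j, v j ∈ WSpan B ℓ (fun q => w q + e j))
    (hω : ∀ u : Fin n → Grid a b, ω (fun j => B (u j)) ∈ DegLE ℓ (m - ∑ j, w (u j))) :
    ω v ∈ DegLE ℓ (m + ∑ j, e j) := by
  classical
  choose t ht hv' using hv
  rw [funext hv']
  have := ω.toMultilinearMap.map_sum (fun j q => t j q • B q)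
  rw [AlternatingMap.coe_multilinearMap] at this
  rw [this]
  refine Submodule.sum_mem _ fun u _ => ?_
  rw [← AlternatingMap.coe_multilinearMap, MultilinearMap.map_smul_univ, smul_eq_mul]
  have h1 := DegLE.prod Finset.univ (fun j => t j (u j)) _ (fun j _ => ht j (u j))
  refine DegLE.mono ?_ (DegLE.mul h1 (hω u))
  rw [Finset.sum_add_distrib]
  omega

/-- The standard basis vectors. -/
def stdv (P : Grid a b) : Vec k a b := by classical exact Pi.single P 1

theorem stdv_apply (P Q : Grid a b) : (stdv P : Vec k a b) Q = if Q = P then 1 else 0 := by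
  classical
  simp [stdv, Pi.single_apply]

/-- The values of the form on standard basis vectors have degree at most `m`. -/
def LauForm.StdLE (ω : LauForm k a b n) (ℓ : ℤ × ℤ →+ ℤ) (m : ℤ) : Prop :=
  ∀ u : Fin n → Grid a b, ω (fun j => stdv (u j)) ∈ DegLE ℓ m

theorem LauForm.StdLE.add {ω ω' : LauForm k a b n} {m : ℤ} (h : ω.StdLE ℓ m) (h' : ω'.StdLE ℓ m) :
    (ω + ω').StdLE ℓ m := fun u => add_mem (h u) (h' u)

theorem LauForm.StdLE.sub {ω ω' : LauForm k a b n} {m : ℤ} (h : ω.StdLE ℓ m) (h' : ω'.StdLE ℓ m) :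
    (ω - ω').StdLE ℓ m := fun u => sub_mem (h u) (h' u)

theorem LauForm.StdLE.mono {ω : LauForm k a b n} {m m' : ℤ} (hm : m ≤ m') (h : ω.StdLE ℓ m) :
    ω.StdLE ℓ m' := fun u => DegLE.mono hm (h u)

theorem mem_wspan_stdv {m : ℤ} {v : Vec k a b} (h : ∀ P, v P ∈ DegLE ℓ m) :
    v ∈ WSpan stdv ℓ (fun _ => m) := by
  refine ⟨v, h, ?_⟩
  ext1 P
  simp [Finset.sum_apply, stdv_apply]

theorem LauForm.StdLE.apply_mem {ω : LauForm k a b n} {m : ℤ} (h : ω.StdLE ℓ m) (e : Fin n → ℤ)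
    (v : Fin n → Vec k a b) (hv : ∀ j P, v j P ∈ DegLE ℓ (e j)) :
    ω v ∈ DegLE ℓ (m + ∑ j, e j) := by
  refine ω.apply_mem_degLE (B := stdv) (w := fun _ => 0) e v (fun j => ?_) (fun u => ?_)
  · simpa using mem_wspan_stdv (hv j)
  · simpa using h u

theorem LauForm.stdLE_of_wspan {ω : LauForm k a b n} {m : ℤ} (hB : ∀ P, stdv P ∈ WSpan B ℓ w)
    (hω : ∀ u : Fin n → Grid a b, ω (fun j => B (u j)) ∈ DegLE ℓ (m - ∑ j, w (u j))) :
    ω.StdLE ℓ m := by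
  intro u
  simpa using ω.apply_mem_degLE (w := w) (fun _ => 0) (fun j => stdv (u j))
    (fun j => by simpa using hB (u j)) hω

theorem stdv_span : Submodule.span (Lau k) (Set.range (stdv : Grid a b → Vec k a b)) = ⊤ := by
  classical
  rw [eq_top_iff]
  intro v _
  have : v = ∑ P, v P • (stdv P : Vec k a b) := by
    ext1 P
    simp [Finset.sum_apply, stdv_apply]
  rw [this]
  exact Submodule.sum_mem _ fun q _ =>
    Submodule.smul_mem _ _ (Submodule.subset_span (Set.mem_range_self q))

/-- A family indexed by the lattice points which spans the standard basis is a basis. -/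
theorem exists_basis (hB : ∀ P, stdv P ∈ WSpan B ℓ w) :
    ∃ β : Module.Basis (Grid a b) (Lau k) (Vec k a b), ∀ P, β P = B P := by
  have hspan : ⊤ ≤ Submodule.span (Lau k) (Set.range B) := by
    rw [← stdv_span, Submodule.span_le]
    rintro _ ⟨P, rfl⟩
    exact WSpan.le_span (hB P)
  have hsurj : Function.Surjective (Fintype.linearCombination (Lau k) B) := by
    rw [← LinearMap.range_eq_top, Fintype.range_linearCombination]
    exact top_le_iff.mp hspan
  have hinj := OrzechProperty.injective_of_surjective_endomorphism _ hsurj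
  refine ⟨Module.Basis.mk ?_ hspan, fun P => Module.Basis.mk_apply _ _ _⟩
  exact linearIndependent_iff_injective_fintypeLinearCombination.mpr hinj

/-- For an additive map `τ`, the form whose values on the basis `β` are obtained by applying
`τ`. -/
theorem LauForm.exists_compose (β : Module.Basis (Grid a b) (Lau k) (Vec k a b))
    (τ : Lau k →+ Lau k) (ω : LauForm k a b n) :
    ∃ ω' : LauForm k a b n, ∀ u : Fin n → Grid a b,
      ω' (fun j => β (u j)) = τ (ω (fun j => β (u j))) := by
  classical
  let _ : LinearOrder (Grid a b) := LinearOrder.lift' _ (Fintype.equivFin (Grid a b)).injective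
  let F : ⋀[Lau k]^n (Vec k a b) →ₗ[Lau k] Lau k := (β.exteriorPower n).constr (Lau k)
    (fun S => τ (ω (fun j => β (Set.powersetCard.ofFinEmbEquiv.symm S j))))
  refine ⟨exteriorPower.alternatingMapLinearEquiv.symm F, fun u => ?_⟩
  have key : ∀ S : Set.powersetCard (Grid a b) n,
      exteriorPower.alternatingMapLinearEquiv.symm F
        (fun j => β (Set.powersetCard.ofFinEmbEquiv.symm S j)) =
      τ (ω (fun j => β (Set.powersetCard.ofFinEmbEquiv.symm S j))) := by
    intro S
    rw [exteriorPower.alternatingMapLinearEquiv_symm_apply]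
    have := (β.exteriorPower n).constr_basis (Lau k)
      (fun S => τ (ω (fun j => β (Set.powersetCard.ofFinEmbEquiv.symm S j)))) S
    rw [exteriorPower.basis_apply] at this
    exact this
  by_cases hu : Function.Injective u
  · let S : Set.powersetCard (Grid a b) n :=
      ⟨Finset.univ.map ⟨u, hu⟩, by simp [Set.powersetCard]⟩
    have hS : ∀ j, ∃ i, Set.powersetCard.ofFinEmbEquiv.symm S i = u j := by
      intro j
      have : u j ∈ Set.range (Set.powersetCard.ofFinEmbEquiv.symm S) := by
        rw [Set.powersetCard.mem_range_ofFinEmbEquiv_symm_iff_mem]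
        show u j ∈ Finset.univ.map ⟨u, hu⟩
        simp
      exact this
    choose σ hσ using hS
    have hσi : Function.Injective σ := fun i j h => hu (by rw [← hσ, ← hσ, h])
    let e : Equiv.Perm (Fin n) := Equiv.ofBijective σ (Finite.injective_iff_bijective.mp hσi)
    have hu' : (fun j => β (u j)) =
        (fun j => β (Set.powersetCard.ofFinEmbEquiv.symm S j)) ∘ e := by
      funext j
      simp [e, hσ]
    rw [hu', AlternatingMap.map_perm, AlternatingMap.map_perm, key S]
    rcases Int.units_eq_one_or (Equiv.Perm.sign e) with h | h <;> simp [h]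
  · have hu' : ¬ Function.Injective (fun j => β (u j)) :=
      fun h => hu fun i j hij => h (by simp [hij])
    rw [AlternatingMap.map_eq_zero_of_not_injective _ _ hu',
      AlternatingMap.map_eq_zero_of_not_injective _ _ hu', map_zero]

end Forms

section Bases

variable {k : Type*} [Field k] {a b n : ℕ}

/-- The vector `x^{-r}·(x^i z^j)`, truncated to the columns `i ≥ r`. -/
def gv (r : ℕ) : Vec k a b := fun P =>
  if r ≤ (P.1 : ℕ) then mon k ((P.1 : ℤ) - r, (P.2 : ℤ)) else 0

/-- The complementary part of `gv r`, supported on the columns `i < r`. -/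
def gm (r : ℕ) : Vec k a b := fun P =>
  if (P.1 : ℕ) < r then -mon k ((P.1 : ℤ) - r, (P.2 : ℤ)) else 0

/-- The evaluation vector `(x^i z^j)`. -/
def ev : Vec k a b := gv 0

/-- The vector `z^{j-s}` on the part `j ≥ s` of column `i`. -/
def fv (i s : ℕ) : Vec k a b := fun P =>
  if (P.1 : ℕ) = i ∧ s ≤ (P.2 : ℕ) then mon k (0, (P.2 : ℤ) - s) else 0

/-- The vector `-z^{j-s}` on the part `j < s` of column `i`. -/
def fv' (i s : ℕ) : Vec k a b := fun P =>
  if (P.1 : ℕ) = i ∧ (P.2 : ℕ) < s then -mon k (0, (P.2 : ℤ) - s) else 0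

theorem stdv_eq_fv (P : Grid a b) :
    (stdv P : Vec k a b) = fv P.1 P.2 - mon k (0, 1) • fv P.1 ((P.2 : ℕ) + 1) := by
  ext1 Q
  obtain ⟨i, j⟩ := P
  obtain ⟨i', j'⟩ := Q
  simp only [stdv_apply, fv, Pi.sub_apply, Pi.smul_apply, smul_eq_mul, mul_ite, mon_mul_mon,
    mul_zero, Prod.mk.injEq, Fin.ext_iff]
  rcases eq_or_ne (i' : ℕ) i with h | h
  · rcases lt_trichotomy (j' : ℕ) j with h' | h' | h'
    · rw [if_neg (by omega), if_neg (by omega), if_neg (by omega), sub_zero]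
    · rw [if_pos (by omega), if_pos (by omega), if_neg (by omega), sub_zero, h', sub_self]
      exact mon_zero.symm
    · rw [if_neg (by omega), if_pos (by omega), if_pos (by omega), eq_comm, sub_eq_zero]
      congr 1
      ext <;> simp; ring
  · rw [if_neg (by omega), if_neg (by omega), if_neg (by omega), sub_zero]

theorem fv'_eq_fv (i s : ℕ) :
    (fv' i s : Vec k a b) = fv i s - mon k (0, -(s : ℤ)) • fv i 0 := by
  ext1 Q
  obtain ⟨i', j'⟩ := Q
  simp only [fv, fv', Pi.sub_apply, Pi.smul_apply, smul_eq_mul, mul_ite, mon_mul_mon,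
    mul_zero]
  rcases eq_or_ne (i' : ℕ) i with h | h
  · have e : ((0, -(s : ℤ)) + (0, (j' : ℤ) - ((0 : ℕ) : ℤ)) : ℤ × ℤ) = (0, (j' : ℤ) - s) := by
      ext <;> simp; ring
    rw [e]
    rcases lt_or_ge (j' : ℕ) s with h' | h'
    · rw [if_pos (by omega), if_neg (by omega), if_pos (by omega), zero_sub]
    · rw [if_neg (by omega), if_pos (by omega), if_pos (by omega), sub_self]
  · rw [if_neg (by omega), if_neg (by omega), if_neg (by omega), sub_zero]

theorem fv_zero_eq_gv (i : ℕ) :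
    (fv i 0 : Vec k a b) = gv i - mon k (1, 0) • gv (i + 1) := by
  ext1 Q
  obtain ⟨i', j'⟩ := Q
  simp only [fv, gv, Pi.sub_apply, Pi.smul_apply, smul_eq_mul, mul_ite, mon_mul_mon,
    mul_zero]
  rcases lt_trichotomy (i' : ℕ) i with h | h | h
  · rw [if_neg (by omega), if_neg (by omega), if_neg (by omega), sub_zero]
  · rw [if_pos (by omega), if_pos (by omega), if_neg (by omega), sub_zero]
    simp [h]
  · rw [if_neg (by omega), if_pos (by omega), if_pos (by omega), eq_comm, sub_eq_zero]
    congr 1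
    ext <;> simp; ring

theorem fv_eq_zero (i : ℕ) {s : ℕ} (h : b < s) : (fv i s : Vec k a b) = 0 := by
  ext1 Q
  have := Q.2.isLt
  simp only [fv, Pi.zero_apply]
  rw [if_neg (by omega)]

theorem gv_eq_zero {r : ℕ} (h : a < r) : (gv r : Vec k a b) = 0 := by
  ext1 Q
  have := Q.1.isLt
  simp only [gv, Pi.zero_apply]
  rw [if_neg (by omega)]

theorem gv_eq_ev (r : ℕ) : (gv r : Vec k a b) = mon k (-(r : ℤ), 0) • ev + gm r := by
  ext1 Q
  obtain ⟨i', j'⟩ := Q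
  simp only [ev, gm, gv, Pi.add_apply, Pi.smul_apply, smul_eq_mul, mul_ite, mon_mul_mon,
    mul_zero]
  have e : ((-(r : ℤ), 0) + ((i' : ℤ) - ((0 : ℕ) : ℤ), (j' : ℤ)) : ℤ × ℤ) =
      ((i' : ℤ) - r, (j' : ℤ)) := by
    ext <;> simp; ring
  rw [e, if_pos (Nat.zero_le _)]
  rcases lt_or_ge (i' : ℕ) r with h | h
  · rw [if_neg (by omega), if_pos (by omega), add_neg_cancel]
  · rw [if_pos (by omega), if_neg (by omega), add_zero]

theorem ev_eq_sum_fv : (ev : Vec k a b) = ∑ i : Fin (a + 1), mon k ((i : ℤ), 0) • fv i 0 := by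
  ext1 Q
  obtain ⟨i', j'⟩ := Q
  simp only [ev, gv, fv, Finset.sum_apply, Pi.smul_apply, smul_eq_mul, mul_ite, mon_mul_mon,
    mul_zero]
  rw [Finset.sum_eq_single i']
  · simp
  · intro i _ hi
    rw [if_neg]
    rintro ⟨h, -⟩
    exact hi (Fin.ext h.symm)
  · simp

variable (k a b) in
/-- The basis consisting of the `gv r` and the `fv i s` with `s ≥ 1`. -/
def bv (P : Grid a b) : Vec k a b := if (P.2 : ℕ) = 0 then gv P.1 else fv P.1 P.2

variable (k a b) in
/-- The basis consisting of the `gv r` and the `fv' i s` with `s ≥ 1`. -/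
def bv' (P : Grid a b) : Vec k a b := if (P.2 : ℕ) = 0 then gv P.1 else fv' P.1 P.2

variable (k a b) in
/-- The basis consisting of all the `fv i s`. -/
def rb (P : Grid a b) : Vec k a b := fv P.1 P.2

variable {ℓ : ℤ × ℤ →+ ℤ} {w : Grid a b → ℤ}

theorem stdv_mem_wspan_rb (h0 : ∀ P, 0 ≤ w P) (h1 : ∀ P, ℓ (0, 1) ≤ w P) (P : Grid a b) :
    (stdv P : Vec k a b) ∈ WSpan (rb k a b) ℓ w := by
  rw [stdv_eq_fv]
  refine sub_mem (WSpan.mem_self (B := rb k a b) (h0 P)) ?_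
  by_cases h : (P.2 : ℕ) + 1 < b + 1
  · exact WSpan.smul_mem (B := rb k a b) (q := (P.1, ⟨P.2 + 1, h⟩)) (DegLE.mon_mem (h1 _))
  · rw [fv_eq_zero _ (by omega), smul_zero]
    exact zero_mem _

theorem smul_gv_mem_wspan {B : Grid a b → Vec k a b} (hB : ∀ i, B (i, 0) = gv i)
    (d : ℤ × ℤ) (h : ∀ i, ℓ d ≤ w (i, 0)) (r : ℕ) : mon k d • gv r ∈ WSpan B ℓ w := by
  by_cases hr : r < a + 1
  · have := WSpan.smul_mem (B := B) (q := (⟨r, hr⟩, 0)) (DegLE.mon_mem (k := k) (h ⟨r, hr⟩))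
    rwa [hB] at this
  · rw [gv_eq_zero (by omega), smul_zero]
    exact zero_mem _

theorem smul_fv_mem_wspan_bv {i s : ℕ} (hi : i < a + 1) (hs : s ≠ 0) (d : ℤ × ℤ)
    (h : ∀ P : Grid a b, (P.2 : ℕ) ≠ 0 → ℓ d ≤ w P) :
    mon k d • fv i s ∈ WSpan (bv k a b) ℓ w := by
  by_cases hs' : s < b + 1
  · have := WSpan.smul_mem (B := bv k a b) (q := (⟨i, hi⟩, ⟨s, hs'⟩))
      (DegLE.mon_mem (k := k) (h _ hs))
    rwa [bv, if_neg (by simpa using hs)] at this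
  · rw [fv_eq_zero _ (by omega), smul_zero]
    exact zero_mem _

theorem stdv_mem_wspan_bv (h0 : ∀ P, 0 ≤ w P) (h1 : ∀ i, ℓ (1, 0) ≤ w (i, 0))
    (h2 : ∀ P : Grid a b, (P.2 : ℕ) ≠ 0 → ℓ (0, 1) ≤ w P) (P : Grid a b) :
    (stdv P : Vec k a b) ∈ WSpan (bv k a b) ℓ w := by
  rw [stdv_eq_fv]
  refine sub_mem ?_ (smul_fv_mem_wspan_bv P.1.isLt (by omega) _ h2)
  by_cases hs : (P.2 : ℕ) = 0
  · rw [hs, fv_zero_eq_gv]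
    have hB : ∀ i, bv k a b (i, 0) = gv i := fun i => by simp [bv]
    have := smul_gv_mem_wspan (ℓ := ℓ) (w := w) hB 0 (fun i => by simpa using h0 _) P.1
    rw [mon_zero, one_smul] at this
    exact sub_mem this (smul_gv_mem_wspan hB _ h1 _)
  · have := smul_fv_mem_wspan_bv (k := k) (ℓ := ℓ) (w := w) P.1.isLt hs 0
      (fun P _ => by simpa using h0 _)
    rwa [mon_zero, one_smul] at this

theorem smul_fv'_mem_wspan_bv' {i s : ℕ} (hi : i < a + 1) (hs' : s < b + 1) (d : ℤ × ℤ)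
    (h : ∀ P : Grid a b, (P.2 : ℕ) ≠ 0 → ℓ d ≤ w P) :
    mon k d • fv' i s ∈ WSpan (bv' k a b) ℓ w := by
  by_cases hs : s = 0
  · have : (fv' i s : Vec k a b) = 0 := by
      rw [fv'_eq_fv, hs]
      simp only [Nat.cast_zero, neg_zero]
      rw [show ((0, 0) : ℤ × ℤ) = 0 from rfl, mon_zero, one_smul, sub_self]
    rw [this, smul_zero]
    exact zero_mem _
  · have := WSpan.smul_mem (B := bv' k a b) (q := (⟨i, hi⟩, ⟨s, hs'⟩))
      (DegLE.mon_mem (k := k) (h _ hs))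
    rwa [bv', if_neg (by simpa using hs)] at this

theorem stdv_eq_fv' (P : Grid a b) :
    (stdv P : Vec k a b) = fv' P.1 P.2 - mon k (0, 1) • fv' P.1 ((P.2 : ℕ) + 1) := by
  rw [stdv_eq_fv, fv'_eq_fv, fv'_eq_fv, smul_sub, smul_smul, mon_mul_mon]
  have : ((0, 1) + (0, -(((P.2 : ℕ) + 1 : ℕ) : ℤ)) : ℤ × ℤ) = (0, -((P.2 : ℕ) : ℤ)) := by
    ext <;> simp
  rw [this]
  abel

theorem stdv_mem_wspan_bv' (h0 : ∀ P : Grid a b, (P.2 : ℕ) ≠ 0 → 0 ≤ w P)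
    (h2 : ∀ P : Grid a b, (P.2 : ℕ) ≠ 0 → ℓ (0, 1) ≤ w P)
    (h1 : ∀ i, ℓ (0, -(b : ℤ)) ≤ w (i, 0))
    (h3 : ∀ i, ℓ (1, -(b : ℤ)) ≤ w (i, 0)) (P : Grid a b) :
    (stdv P : Vec k a b) ∈ WSpan (bv' k a b) ℓ w := by
  rw [stdv_eq_fv']
  refine sub_mem ?_ ?_
  · have := smul_fv'_mem_wspan_bv' (k := k) (ℓ := ℓ) (w := w) P.1.isLt P.2.isLt 0
      (fun P h => by simpa using h0 _ h)
    rwa [mon_zero, one_smul] at this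
  by_cases hs : (P.2 : ℕ) + 1 < b + 1
  · exact smul_fv'_mem_wspan_bv' P.1.isLt hs _ h2
  · have hb : (P.2 : ℕ) = b := by omega
    have hB : ∀ i, bv' k a b (i, 0) = gv i := fun i => by simp [bv']
    rw [hb, fv'_eq_fv, fv_eq_zero _ (Nat.lt_succ_self b), zero_sub, fv_zero_eq_gv, smul_neg,
      smul_sub, smul_sub, smul_smul, smul_smul, smul_smul, mon_mul_mon, mon_mul_mon]
    refine neg_mem (sub_mem ?_ ?_)
    · convert smul_gv_mem_wspan (k := k) hB _ h1 P.1 using 3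
      ext <;> simp
    · convert smul_gv_mem_wspan (k := k) hB _ h3 ((P.1 : ℕ) + 1) using 3
      ext <;> simp

/-- The horizontal degree. -/
abbrev xdeg : ℤ × ℤ →+ ℤ := AddMonoidHom.fst ℤ ℤ

/-- The vertical degree. -/
abbrev zdeg : ℤ × ℤ →+ ℤ := AddMonoidHom.snd ℤ ℤ

theorem gv_mem_degLE {r : ℕ} {m : ℤ}
    (h : ∀ i j : ℕ, i ≤ a → j ≤ b → ℓ ((i : ℤ), (j : ℤ)) ≤ m) (P : Grid a b) :
    (gv r : Vec k a b) P ∈ DegLE ℓ m := by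
  have h1 := P.1.isLt
  have h2 := P.2.isLt
  unfold gv
  split_ifs with hr
  · have := h (P.1 - r) P.2 (by omega) (by omega)
    rw [Nat.cast_sub hr] at this
    exact DegLE.mon_mem this
  · exact zero_mem _

theorem fv_mem_degLE {i s : ℕ} {m : ℤ} (h : ∀ j : ℕ, j ≤ b - s → ℓ (0, (j : ℤ)) ≤ m)
    (P : Grid a b) : (fv i s : Vec k a b) P ∈ DegLE ℓ m := by
  have h2 := P.2.isLt
  unfold fv
  split_ifs with hr
  · have := h (P.2 - s) (by omega)
    rw [Nat.cast_sub hr.2] at this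
    exact DegLE.mon_mem this
  · exact zero_mem _

theorem fv'_mem_degLE {i s : ℕ} {m : ℤ}
    (h : ∀ j : ℕ, 1 ≤ j → j ≤ s → ℓ (0, -(j : ℤ)) ≤ m)
    (P : Grid a b) : (fv' i s : Vec k a b) P ∈ DegLE ℓ m := by
  unfold fv'
  split_ifs with hr
  · have := h (s - P.2) (by omega) (by omega)
    rw [Nat.cast_sub hr.2.le, neg_sub] at this
    exact neg_mem (DegLE.mon_mem this)
  · exact zero_mem _

theorem gm_mem_degLE (r : ℕ) (P : Grid a b) : (gm r : Vec k a b) P ∈ DegLE xdeg (-1) := by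
  unfold gm
  split_ifs with hr
  · exact neg_mem (DegLE.mon_mem (by simp; omega))
  · exact zero_mem _

end Bases

section Mixed

variable {k : Type*} [Field k] {a b n : ℕ}

/-- A form kills the evaluation vector. -/
def LauForm.Kills (ω : LauForm k a b n) : Prop :=
  ∀ (v : Fin n → Vec k a b) (t : Fin n), v t = ev → ω v = 0

theorem LauForm.Kills.sub {ω ω' : LauForm k a b n} (h : ω.Kills) (h' : ω'.Kills) :
    (ω - ω').Kills := fun v t ht => by
  rw [AlternatingMap.sub_apply, h v t ht, h' v t ht, sub_zero]

/-- Entries of the arguments of a form killing `ev` matter only modulo multiples of `ev`. -/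
theorem LauForm.Kills.congr {ω : LauForm k a b n} (h : ω.Kills) {v v' : Fin n → Vec k a b}
    (hv : ∀ t, ∃ c : Lau k, v t = c • ev + v' t) : ω v = ω v' := by
  classical
  choose c hc using hv
  have key : ∀ s : Finset (Fin n), ω (s.piecewise v v') = ω v' := by
    intro s
    induction s using Finset.induction_on with
    | empty => simp
    | insert t s ht ih =>
      rw [Finset.piecewise_insert, hc t, AlternatingMap.map_update_add,
        AlternatingMap.map_update_smul, h _ t (by simp), smul_zero, zero_add, ← ih]
      congr 1
      rw [Function.update_eq_self_iff, Finset.piecewise_eq_of_notMem _ _ _ ht]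
  simpa using key Finset.univ

variable (k a b) in
/-- The vectors `gv` and `fv`, indexed by pairs of natural numbers. -/
def nb (P : ℕ × ℕ) : Vec k a b := if P.2 = 0 then gv P.1 else fv P.1 P.2

variable (k a b) in
/-- The vectors `gv` and `fv'`, indexed by pairs of natural numbers. -/
def nb' (P : ℕ × ℕ) : Vec k a b := if P.2 = 0 then gv P.1 else fv' P.1 P.2

variable (k a b) in
/-- The tuple with entries `nb' (u t)` for `t ∈ H` and `nb (u t)` for `t ∉ H`. -/
def mixed (u : Fin n → ℕ × ℕ) (H : Finset (Fin n)) (t : Fin n) : Vec k a b :=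
  if t ∈ H then nb' k a b (u t) else nb k a b (u t)

/-- The number of indices in the bottom row. -/
def nbot (u : Fin n → ℕ × ℕ) : ℕ := (Finset.univ.filter fun t => (u t).2 = 0).card

theorem mixed_update (u : Fin n → ℕ × ℕ) (H : Finset (Fin n)) (t : Fin n) (i : ℕ) :
    mixed k a b (Function.update u t (i, 0)) H = Function.update (mixed k a b u H) t (gv i) := by
  classical
  funext t'
  by_cases h : t' = t
  · subst h; simp [mixed, nb, nb']
  · simp [mixed, h]

theorem mixed_insert (u : Fin n → ℕ × ℕ) (H : Finset (Fin n)) (t : Fin n) :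
    mixed k a b u (insert t H) = Function.update (mixed k a b u H) t (nb' k a b (u t)) := by
  classical
  funext t'
  by_cases h : t' = t
  · subst h; simp [mixed]
  · simp [mixed, h]

theorem nbot_update (u : Fin n → ℕ × ℕ) (t : Fin n) (ht : (u t).2 ≠ 0) (i : ℕ) :
    nbot (Function.update u t (i, 0)) = nbot u + 1 := by
  classical
  unfold nbot
  rw [← Finset.card_insert_of_notMem (s := Finset.univ.filter fun t => (u t).2 = 0) (a := t)
    (by simpa using ht)]
  congr 1
  ext t'
  by_cases h : t' = t
  · subst h; simp
  · simp [h]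

/-- How the value on a mixed tuple changes when an entry `nb` is replaced by `nb'`. -/
theorem mixed_insert_coeff (ω : LauForm k a b n) (u : Fin n → ℕ × ℕ) (H : Finset (Fin n))
    {t : Fin n} (ht : t ∉ H) (hs : (u t).2 ≠ 0) (d e : ℤ) :
    (ω (mixed k a b u (insert t H))).coeff (d, e) = (ω (mixed k a b u H)).coeff (d, e)
      - (ω (mixed k a b (Function.update u t ((u t).1, 0)) H)).coeff (d, e + (u t).2)
      + (ω (mixed k a b (Function.update u t ((u t).1 + 1, 0)) H)).coeff
          (d - 1, e + (u t).2) := by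
  classical
  have h1 : mixed k a b u H = Function.update (mixed k a b u H) t (fv (u t).1 (u t).2) := by
    rw [eq_comm, Function.update_eq_self_iff]
    simp [mixed, nb, hs, ht]
  rw [mixed_insert, nb', if_neg hs, fv'_eq_fv, fv_zero_eq_gv, AlternatingMap.map_update_sub,
    ← h1, AlternatingMap.map_update_smul, AlternatingMap.map_update_sub,
    AlternatingMap.map_update_smul, mixed_update, mixed_update, smul_sub, smul_smul,
    mon_mul_mon, smul_eq_mul, smul_eq_mul, AddMonoidAlgebra.coeff_sub,
    AddMonoidAlgebra.coeff_sub]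
  simp only [Finsupp.sub_apply, mon_mul_coeff]
  rw [sub_sub_eq_add_sub, sub_add_eq_add_sub]
  congr 3 <;> ext <;> simp

theorem mixed_insert_of_bot (u : Fin n → ℕ × ℕ) (H : Finset (Fin n)) {t : Fin n}
    (hs : (u t).2 = 0) : mixed k a b u (insert t H) = mixed k a b u H := by
  classical
  rw [mixed_insert, Function.update_eq_self_iff]
  simp [mixed, nb, nb', hs]

/-- A pair of forms killing `ev` whose difference splits into a part of nonpositive and a part
of nonnegative horizontal degree, the first form having nonnegative and the second one
nonpositive vertical degree. -/
structure EdgePair (ω₀ ω₁ D₀ D₁ : LauForm k a b n) : Prop where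
  sub_eq : ω₁ - ω₀ = D₁ - D₀
  kills₀ : ω₀.Kills
  kills₁ : ω₁.Kills
  killsD : D₁.Kills
  stdD₁ : D₁.StdLE xdeg 0
  stdD₀ : D₀.StdLE (-xdeg) 0
  std₀ : ω₀.StdLE (-zdeg) 0
  std₁ : ω₁.StdLE zdeg 0

theorem mixed_mem_degLE_neg_xdeg (u : Fin n → ℕ × ℕ) (H : Finset (Fin n)) (t : Fin n)
    (P : Grid a b) : mixed k a b u H t P ∈ DegLE (-xdeg) 0 := by
  unfold mixed nb nb'
  split_ifs
  · exact gv_mem_degLE (by intros; simp) P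
  · exact fv'_mem_degLE (by intros; simp) P
  · exact gv_mem_degLE (by intros; simp) P
  · exact fv_mem_degLE (by intros; simp) P

theorem sum_bot (u : Fin n → ℕ × ℕ) (x y : ℤ) :
    ∑ t, (if (u t).2 = 0 then x else y) = nbot u * x + (n - nbot u) * y := by
  classical
  rw [Finset.sum_ite, Finset.sum_const, Finset.sum_const, nsmul_eq_mul, nsmul_eq_mul]
  have := Finset.card_filter_add_card_filter_not (s := (Finset.univ : Finset (Fin n)))
    (fun t => (u t).2 = 0)
  rw [Finset.card_fin] at this
  have h' : ((Finset.univ.filter fun t => ¬ (u t).2 = 0).card : ℤ) = n - nbot u := by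
    unfold nbot; omega
  rw [h']; rfl

variable {ω₀ ω₁ D₀ D₁ : LauForm k a b n}

theorem EdgePair.coeff_eq (h : EdgePair ω₀ ω₁ D₀ D₁) (u : Fin n → ℕ × ℕ) (H : Finset (Fin n))
    {c : ℕ} (hc : 1 ≤ c) (hc' : c < nbot u) (σ : ℤ) :
    (ω₁ (mixed k a b u H)).coeff (-c, σ) = (ω₀ (mixed k a b u H)).coeff (-c, σ) := by
  have e : ω₁ (mixed k a b u H) - ω₀ (mixed k a b u H)
      = D₁ (mixed k a b u H) - D₀ (mixed k a b u H) := by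
    rw [← AlternatingMap.sub_apply, h.sub_eq, AlternatingMap.sub_apply]
  have h0 : D₀ (mixed k a b u H) ∈ DegLE (-xdeg) 0 := by
    simpa using h.stdD₀.apply_mem (fun _ => 0) _ (mixed_mem_degLE_neg_xdeg u H)
  have h1 : D₁ (mixed k a b u H) ∈ DegLE xdeg (-(nbot u : ℤ)) := by
    rw [h.killsD.congr (v' := fun t => if (u t).2 = 0 then gm (u t).1 else mixed k a b u H t)]
    · have := h.stdD₁.apply_mem (fun t => if (u t).2 = 0 then -1 else 0)
        (fun t => if (u t).2 = 0 then gm (u t).1 else mixed k a b u H t) ?_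
      · rw [sum_bot] at this
        simpa using this
      · intro t P
        split_ifs with hs
        · exact gm_mem_degLE _ P
        · unfold mixed nb nb'
          rw [if_neg hs, if_neg hs]
          split_ifs
          · exact fv'_mem_degLE (by intros; simp) P
          · exact fv_mem_degLE (by intros; simp) P
    · intro t
      by_cases hs : (u t).2 = 0
      · refine ⟨mon k (-((u t).1 : ℤ), 0), ?_⟩
        rw [if_pos hs, ← gv_eq_ev]
        simp [mixed, nb, nb', hs]
      · exact ⟨0, by simp [hs]⟩
  have e' := congrArg (fun f => f.coeff (-(c : ℤ), σ)) e
  simp only [AddMonoidAlgebra.coeff_sub, Finsupp.sub_apply] at e'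
  rw [h0 _ (by simp; omega), h1 _ (by simp; omega), sub_zero] at e'
  exact sub_eq_zero.mp e'

theorem EdgePair.coeff_empty (h : EdgePair ω₀ ω₁ D₀ D₁) (u : Fin n → ℕ × ℕ)
    {c : ℕ} (hc : 1 ≤ c) (hc' : c < nbot u) {σ : ℤ} (hσ : σ < 0) :
    (ω₁ (mixed k a b u ∅)).coeff (-c, σ) = 0 := by
  rw [h.coeff_eq u ∅ hc hc']
  have h0 : ω₀ (mixed k a b u ∅) ∈ DegLE (-zdeg) 0 := by
    have : ∀ t P, mixed k a b u ∅ t P ∈ DegLE (-zdeg) 0 := by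
      intro t P
      simp only [mixed, nb, Finset.notMem_empty, if_false]
      split_ifs
      · exact gv_mem_degLE (by intros; simp) P
      · exact fv_mem_degLE (by intros; simp) P
    simpa using h.std₀.apply_mem (fun _ => 0) (mixed k a b u ∅) this
  exact h0 _ (by simpa using hσ)

theorem EdgePair.coeff_univ (h : EdgePair ω₀ ω₁ D₀ D₁) (hn : n = a * (b + 1))
    (u : Fin n → ℕ × ℕ) (d : ℤ) {σ : ℤ} (hσ : ((b : ℤ) + 1) * (nbot u - a) < σ) :
    (ω₁ (mixed k a b u Finset.univ)).coeff (d, σ) = 0 := by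
  have h0 := h.std₁.apply_mem (fun t => if (u t).2 = 0 then (b : ℤ) else -1)
    (mixed k a b u Finset.univ) (by
      intro t P
      simp only [mixed, nb', Finset.mem_univ, if_true]
      split_ifs
      · exact gv_mem_degLE (by intros; simp; omega) P
      · exact fv'_mem_degLE (by intros; simp; omega) P)
  rw [sum_bot] at h0
  refine h0 _ ?_
  have : (n : ℤ) = a * (b + 1) := by rw [hn]; push_cast; ring
  rw [this]
  simp only [AddMonoidHom.coe_snd]
  linarith

theorem LauForm.Kills.apply_mixed_of_eq {ω : LauForm k a b n} (h : ω.Kills) {u : Fin n → ℕ × ℕ}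
    {H : Finset (Fin n)} {t : Fin n} (ht : u t = (0, 0)) : ω (mixed k a b u H) = 0 :=
  h _ t (by simp [mixed, nb, nb', ht, ev])

theorem LauForm.apply_mixed_of_lt {ω : LauForm k a b n} {u : Fin n → ℕ × ℕ}
    {H : Finset (Fin n)} {t : Fin n} (ht : (u t).2 = 0) (ht' : a < (u t).1) :
    ω (mixed k a b u H) = 0 :=
  ω.map_coord_zero t (by simp [mixed, nb, nb', ht, gv_eq_zero ht'])

theorem LauForm.apply_mixed_of_eq {ω : LauForm k a b n} {u : Fin n → ℕ × ℕ}
    {H : Finset (Fin n)} {t t' : Fin n} (hne : t ≠ t') (h : u t = u t') (ht : (u t).2 = 0) :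
    ω (mixed k a b u H) = 0 := by
  refine ω.map_eq_zero_of_eq _ (i := t) (j := t') ?_ hne
  have ht' := ht
  rw [h] at ht'
  simp [mixed, nb, nb', h, ht']

theorem LauForm.Kills.apply_mixed_of_nbot {ω : LauForm k a b n} (h : ω.Kills)
    {u : Fin n → ℕ × ℕ} (hu : a < nbot u) (H : Finset (Fin n)) : ω (mixed k a b u H) = 0 := by
  classical
  by_cases h0 : ∃ t, (u t).2 = 0 ∧ ((u t).1 = 0 ∨ a < (u t).1)
  · obtain ⟨t, ht, h1 | h1⟩ := h0
    · exact h.apply_mixed_of_eq (t := t) (Prod.ext h1 ht)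
    · exact LauForm.apply_mixed_of_lt ht h1
  push Not at h0
  obtain ⟨t, ht, t', ht', hne, heq⟩ := Finset.exists_ne_map_eq_of_card_lt_of_maps_to
    (s := Finset.univ.filter fun t => (u t).2 = 0) (t := Finset.Icc 1 a) (f := fun t => (u t).1)
    (by simpa [nbot] using hu) (by
      intro t ht
      have ht : (u t).2 = 0 := by simpa using ht
      have := h0 t ht
      simp only [Finset.coe_Icc, Set.mem_Icc]
      omega)
  simp only [Finset.mem_filter, Finset.mem_univ, true_and] at ht ht'
  exact LauForm.apply_mixed_of_eq hne (Prod.ext heq (ht.trans ht'.symm)) ht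

/-- All the coefficients in the critical range vanish on tuples with `m` bottom indices. -/
def BotVanish (ω : LauForm k a b n) (m : ℕ) : Prop :=
  ∀ (u : Fin n → ℕ × ℕ), (∀ t, (u t).2 ≤ b) → nbot u = m → ∀ (H : Finset (Fin n)) (c : ℕ) (σ : ℤ),
    1 ≤ c → c < m → (ω (mixed k a b u H)).coeff (-c, σ) = 0

theorem BotVanish.coeff_eq {ω : LauForm k a b n} {m : ℕ} (h : BotVanish ω (m + 1))
    {u : Fin n → ℕ × ℕ} (hu : ∀ t, (u t).2 ≤ b) (hm : nbot u = m) (H : Finset (Fin n)) (c : ℕ)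
    (σ : ℤ) (hc : 1 ≤ c) (hc' : c < m) :
    (ω (mixed k a b u H)).coeff (-c, σ) = (ω (mixed k a b u ∅)).coeff (-c, σ) := by
  classical
  induction H using Finset.induction_on with
  | empty => rfl
  | insert t H ht ih =>
    by_cases hs : (u t).2 = 0
    · rw [mixed_insert_of_bot u H hs, ih]
    · have hu' : ∀ i t', (Function.update u t (i, 0) t').2 ≤ b := by
        intro i t'
        by_cases h : t' = t
        · subst h; simp
        · simpa [h] using hu t'
      rw [mixed_insert_coeff ω u H ht hs, ih,
        h _ (hu' _) (by rw [nbot_update _ _ hs, hm]) H c _ hc (by omega)]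
      have := h _ (hu' ((u t).1 + 1)) (by rw [nbot_update _ _ hs, hm]) H (c + 1) (σ + (u t).2)
        (by omega) (by omega)
      rw [show (-(c : ℤ) - 1) = -((c + 1 : ℕ) : ℤ) by push_cast; ring, this, sub_zero, add_zero]

theorem EdgePair.botVanish_of_lt (h : EdgePair ω₀ ω₁ D₀ D₁) {m : ℕ} (hm : a < m) :
    BotVanish ω₁ m := by
  intro u _ hu H c σ _ _
  rw [h.kills₁.apply_mixed_of_nbot (by omega)]
  rfl

theorem EdgePair.botVanish (h : EdgePair ω₀ ω₁ D₀ D₁) (hn : n = a * (b + 1))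
    (ha : BotVanish ω₁ a) (m : ℕ) : BotVanish ω₁ m := by
  rcases lt_or_ge a m with hm | hm
  · exact h.botVanish_of_lt hm
  induction hm using Nat.decreasingInduction with
  | self => exact ha
  | of_succ m hm ih =>
    intro u hu hum H c σ hc hc'
    rw [ih.coeff_eq hu hum H c σ hc hc']
    rcases lt_or_ge σ 0 with hσ | hσ
    · exact h.coeff_empty u hc (by omega) hσ
    · rw [← ih.coeff_eq hu hum Finset.univ c σ hc hc']
      refine h.coeff_univ hn u _ (lt_of_lt_of_le ?_ hσ)
      refine mul_neg_of_pos_of_neg (by omega) (by omega)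

/-- For `a` bottom indices only the coefficients of vertical degree zero can be nonzero. -/
theorem EdgePair.coeff_eq_zero (h : EdgePair ω₀ ω₁ D₀ D₁) (hn : n = a * (b + 1))
    {u : Fin n → ℕ × ℕ} (hu : ∀ t, (u t).2 ≤ b) (hm : nbot u = a) (H : Finset (Fin n)) {c : ℕ}
    {σ : ℤ} (hc : 1 ≤ c) (hc' : c < a) (hσ : σ ≠ 0) :
    (ω₁ (mixed k a b u H)).coeff (-c, σ) = 0 := by
  have hv := h.botVanish_of_lt (Nat.lt_succ_self a)
  rw [hv.coeff_eq hu hm H c σ hc hc']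
  rcases lt_or_gt_of_ne hσ with hσ | hσ
  · exact h.coeff_empty u hc (by omega) hσ
  · rw [← hv.coeff_eq hu hm Finset.univ c σ hc hc']
    refine h.coeff_univ hn u _ ?_
    rw [hm]
    simpa using hσ

/-- The critical coefficients. -/
def crit (ω : LauForm k a b n) (c : ℕ) (u : Fin n → ℕ × ℕ) : k :=
  (ω (mixed k a b u ∅)).coeff (-c, 0)

theorem EdgePair.botVanish_of_crit (h : EdgePair ω₀ ω₁ D₀ D₁) (hn : n = a * (b + 1))
    (hcrit : ∀ u : Fin n → ℕ × ℕ, (∀ t, (u t).2 ≤ b) → nbot u = a → ∀ c, 1 ≤ c → c < a →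
      crit ω₁ c u = 0) : BotVanish ω₁ a := by
  intro u hu hm H c σ hc hc'
  by_cases hσ : σ = 0
  · subst hσ
    rw [(h.botVanish_of_lt (Nat.lt_succ_self a)).coeff_eq hu hm H c 0 hc hc']
    exact hcrit u hu hm c hc hc'
  · exact h.coeff_eq_zero hn hu hm H hc hc' hσ

/-- The linear relation among the critical coefficients. -/
theorem EdgePair.sum_crit (h : EdgePair ω₀ ω₁ D₀ D₁) (hn : n = a * (b + 1))
    {u : Fin n → ℕ × ℕ} (hu : ∀ t, (u t).2 ≤ b) (hm : nbot u + 1 = a) {c s : ℕ} (hc : 1 ≤ c)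
    (hc' : c + 1 < a) (hs : 1 ≤ s) (hs' : s ≤ b) :
    ∑ t ∈ Finset.univ.filter (fun t => (u t).2 = s),
      (crit ω₁ c (Function.update u t ((u t).1, 0))
        - crit ω₁ (c + 1) (Function.update u t ((u t).1 + 1, 0))) = 0 := by
  classical
  have key : ∀ H : Finset (Fin n), (ω₁ (mixed k a b u H)).coeff (-c, -s) =
      - ∑ t ∈ H.filter (fun t => (u t).2 = s),
        (crit ω₁ c (Function.update u t ((u t).1, 0))
          - crit ω₁ (c + 1) (Function.update u t ((u t).1 + 1, 0))) := by
    intro H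
    induction H using Finset.induction_on with
    | empty =>
      simp only [Finset.filter_empty, Finset.sum_empty, neg_zero]
      exact h.coeff_empty u hc (by omega) (by omega)
    | insert t H ht ih =>
      by_cases h0 : (u t).2 = 0
      · rw [mixed_insert_of_bot u H h0, ih, Finset.filter_insert, if_neg (by omega)]
      have hu' : ∀ i t', (Function.update u t (i, 0) t').2 ≤ b := by
        intro i t'
        by_cases h : t' = t
        · subst h; simp
        · simpa [h] using hu t'
      have hm' : ∀ i, nbot (Function.update u t (i, 0)) = a := fun i => by
        rw [nbot_update _ _ h0, hm]
      have hv := h.botVanish_of_lt (Nat.lt_succ_self a)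
      rw [mixed_insert_coeff ω₁ u H ht h0, ih,
        show (-(c : ℤ) - 1) = -((c + 1 : ℕ) : ℤ) by push_cast; ring]
      by_cases hts : (u t).2 = s
      · rw [Finset.filter_insert, if_pos hts, Finset.sum_insert (by simp [ht]), hts,
          hv.coeff_eq (hu' _) (hm' _) H c _ hc (by omega),
          hv.coeff_eq (hu' _) (hm' _) H (c + 1) _ (by omega) (by omega), neg_add_cancel]
        unfold crit
        ring
      · rw [Finset.filter_insert, if_neg hts,
          h.coeff_eq_zero hn (hu' _) (hm' _) H hc (by omega) (by omega),
          h.coeff_eq_zero hn (hu' _) (hm' _) H (c := c + 1) (by omega) (by omega) (by omega),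
          sub_zero, add_zero]
  have h1 := key Finset.univ
  rw [h.coeff_univ hn u, eq_comm, neg_eq_zero] at h1
  · exact h1
  · have : (nbot u : ℤ) - a = -1 := by omega
    rw [this]; omega

end Mixed

theorem update_injective {α β : Type*} [DecidableEq α] {u : α → β} {t : α} {P : β}
    (hu : ∀ i j, i ≠ t → j ≠ t → u i = u j → i = j) (hP : ∀ i, i ≠ t → u i ≠ P) :
    Function.Injective (Function.update u t P) := by
  intro i j hij
  by_cases hi : i = t <;> by_cases hj : j = t
  · rw [hi, hj]
  · subst hi
    simp only [Function.update_self, Function.update_of_ne hj] at hij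
    exact absurd hij.symm (hP j hj)
  · subst hj
    simp only [Function.update_self, Function.update_of_ne hi] at hij
    exact absurd hij (hP i hi)
  · simp only [Function.update_of_ne hi, Function.update_of_ne hj] at hij
    exact hu i j hi hj hij

section Holes

variable {k : Type*} [Field k] {a b n : ℕ}

theorem LauForm.coeff_eq_zero_of_range_eq (ω : LauForm k a b n) {α : Type*}
    (B : α → Vec k a b) {u u₀ : Fin n → α} (hu : Function.Injective u)
    (h : ∀ j, ∃ i, u₀ i = u j) {d : ℤ × ℤ} (h0 : (ω fun j => B (u₀ j)).coeff d = 0) :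
    (ω fun j => B (u j)).coeff d = 0 := by
  choose σ hσ using h
  have hσi : Function.Injective σ := fun i j h => hu (by rw [← hσ, ← hσ, h])
  let e : Equiv.Perm (Fin n) := Equiv.ofBijective σ (Finite.injective_iff_bijective.mp hσi)
  have hu' : (fun j => B (u j)) = (fun j => B (u₀ j)) ∘ e := by
    funext j
    simp [e, hσ]
  rw [hu', AlternatingMap.map_perm]
  rcases Int.units_eq_one_or (Equiv.Perm.sign e) with h | h <;> simp [h, h0]

/-- A set of `b` lattice points of `[0,a] × [1,b]`. -/
structure IsHoles (a b : ℕ) (E : Finset (ℕ × ℕ)) : Prop where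
  bounds : ∀ P ∈ E, P.1 ≤ a ∧ 1 ≤ P.2 ∧ P.2 ≤ b
  card_eq : E.card = b

/-- An injective tuple of lattice points of `[0,a] × [0,b]` avoiding the origin and `E`. -/
structure Avoids (a b : ℕ) (u : Fin n → ℕ × ℕ) (E : Finset (ℕ × ℕ)) : Prop where
  inj : Function.Injective u
  mem : ∀ t, (u t).1 ≤ a ∧ (u t).2 ≤ b ∧ u t ≠ (0, 0) ∧ u t ∉ E

theorem Avoids.exists_eq {u : Fin n → ℕ × ℕ} {E : Finset (ℕ × ℕ)} (h : Avoids a b u E)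
    (hE : IsHoles a b E) (hn : n = a * (b + 1)) {P : ℕ × ℕ} (h1 : P.1 ≤ a) (h2 : P.2 ≤ b)
    (h3 : P ≠ (0, 0)) (h4 : P ∉ E) : ∃ t, u t = P := by
  classical
  let S := ((Finset.range (a + 1) ×ˢ Finset.range (b + 1)).erase (0, 0)) \ E
  have hS : ∀ Q, Q ∈ S ↔ Q.1 ≤ a ∧ Q.2 ≤ b ∧ Q ≠ (0, 0) ∧ Q ∉ E := by
    intro Q
    simp only [S, Finset.mem_sdiff, Finset.mem_erase, Finset.mem_product, Finset.mem_range,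
      Nat.lt_succ_iff]
    tauto
  have hcard : S.card = a * (b + 1) := by
    rw [Finset.card_sdiff_of_subset, Finset.card_erase_of_mem, Finset.card_product,
      Finset.card_range, Finset.card_range, hE.card_eq]
    · have : (a + 1) * (b + 1) = a * (b + 1) + b + 1 := by ring
      omega
    · simp
    · intro Q hQ
      have := hE.bounds Q hQ
      simp only [Finset.mem_erase, Finset.mem_product, Finset.mem_range, Nat.lt_succ_iff]
      refine ⟨?_, this.1, this.2.2⟩
      rintro rfl
      omega
  have hsub : Finset.univ.image u ⊆ S := by
    intro Q hQ
    obtain ⟨t, -, rfl⟩ := Finset.mem_image.mp hQ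
    exact (hS _).mpr (h.mem t)
  have heq := Finset.eq_of_subset_of_card_le hsub (by
    rw [hcard, Finset.card_image_of_injective _ h.inj, Finset.card_fin, hn])
  have hP : P ∈ Finset.univ.image u := heq ▸ (hS P).mpr ⟨h1, h2, h3, h4⟩
  simpa using hP

/-- The bottom row of `v` consists of all `(i,0)` with `1 ≤ i ≤ a` except `(r,0)`. -/
structure MissesBot (a b : ℕ) (v : Fin n → ℕ × ℕ) (r : ℕ) : Prop where
  inj : Function.Injective v
  le : ∀ t, (v t).2 ≤ b
  pos : 1 ≤ r
  le_a : r ≤ a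
  bot : ∀ t, (v t).2 = 0 → 1 ≤ (v t).1 ∧ (v t).1 ≤ a ∧ (v t).1 ≠ r
  ex : ∀ i, 1 ≤ i → i ≤ a → i ≠ r → ∃ t, v t = (i, 0)

theorem MissesBot.nbot_eq {v : Fin n → ℕ × ℕ} {r : ℕ} (h : MissesBot a b v r) :
    nbot v + 1 = a := by
  classical
  have : (Finset.univ.filter fun t => (v t).2 = 0).image (fun t => (v t).1)
      = (Finset.Icc 1 a).erase r := by
    ext i
    simp only [Finset.mem_image, Finset.mem_filter, Finset.mem_univ, true_and, Finset.mem_erase,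
      Finset.mem_Icc]
    constructor
    · rintro ⟨t, ht, rfl⟩
      have := h.bot t ht
      tauto
    · rintro ⟨h1, h2, h3⟩
      obtain ⟨t, ht⟩ := h.ex i h2 h3 h1
      exact ⟨t, by simp [ht]⟩
  have hc := congrArg Finset.card this
  rw [Finset.card_image_of_injOn, Finset.card_erase_of_mem (by simp [h.pos, h.le_a]),
    Nat.card_Icc] at hc
  · have := h.pos
    have := h.le_a
    unfold nbot
    omega
  · intro t ht t' ht' heq
    simp only [Finset.coe_filter, Finset.mem_univ, true_and, Set.mem_ofPred_eq] at ht ht'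
    exact h.inj (Prod.ext heq (ht.trans ht'.symm))

variable {ω₀ ω₁ D₀ D₁ : LauForm k a b n}

theorem MissesBot.crit_update {v : Fin n → ℕ × ℕ} {r : ℕ} (h : MissesBot a b v r)
    {ω : LauForm k a b n} (hω : ω.Kills) (c : ℕ) {t : Fin n} (ht : (v t).2 ≠ 0) {j : ℕ}
    (hj : j ≠ r) : crit ω c (Function.update v t (j, 0)) = 0 := by
  unfold crit
  suffices ω (mixed k a b (Function.update v t (j, 0)) ∅) = 0 by rw [this]; rfl
  by_cases h0 : j = 0
  · exact hω.apply_mixed_of_eq (t := t) (by simp [h0])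
  by_cases h1 : a < j
  · exact LauForm.apply_mixed_of_lt (t := t) (by simp) (by simpa using h1)
  obtain ⟨t', ht'⟩ := h.ex j (by omega) (by omega) hj
  have hne : t' ≠ t := by rintro rfl; simp [ht'] at ht
  exact LauForm.apply_mixed_of_eq (t := t) (t' := t') hne.symm (by simp [hne, ht']) (by simp)

section Rules

variable {v : Fin n → ℕ × ℕ} {r c s : ℕ}

theorem MissesBot.sum_right (h : MissesBot a b v (r + 1)) {ω : LauForm k a b n} (hω : ω.Kills)
    (hs : s ≠ 0) {t : Fin n} (ht : v t = (r + 1, s)) :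
    ∑ t ∈ Finset.univ.filter (fun t => (v t).2 = s),
      crit ω c (Function.update v t ((v t).1, 0)) = crit ω c (Function.update v t (r + 1, 0)) := by
  rw [Finset.sum_eq_single t]
  · rw [ht]
  · intro t' ht' hne
    simp only [Finset.mem_filter, Finset.mem_univ, true_and] at ht'
    refine h.crit_update hω c (by omega) fun hr => hne (h.inj ?_)
    rw [ht]
    exact Prod.ext hr ht'
  · simp [ht]

theorem MissesBot.sum_left (h : MissesBot a b v (r + 1)) {ω : LauForm k a b n} (hω : ω.Kills)
    (hs : s ≠ 0) {t : Fin n} (ht : v t = (r, s)) :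
    ∑ t ∈ Finset.univ.filter (fun t => (v t).2 = s),
      crit ω c (Function.update v t ((v t).1 + 1, 0))
        = crit ω c (Function.update v t (r + 1, 0)) := by
  rw [Finset.sum_eq_single t]
  · rw [ht]
  · intro t' ht' hne
    simp only [Finset.mem_filter, Finset.mem_univ, true_and] at ht'
    refine h.crit_update hω c (by omega) fun hr => hne (h.inj ?_)
    rw [ht]
    exact Prod.ext (by simpa using hr) ht'
  · simp [ht]

theorem MissesBot.sum_right_zero (h : MissesBot a b v (r + 1)) {ω : LauForm k a b n}
    (hω : ω.Kills) (hs : s ≠ 0) (hv : ∀ t, v t ≠ (r + 1, s)) :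
    ∑ t ∈ Finset.univ.filter (fun t => (v t).2 = s),
      crit ω c (Function.update v t ((v t).1, 0)) = 0 := by
  refine Finset.sum_eq_zero fun t ht => ?_
  simp only [Finset.mem_filter, Finset.mem_univ, true_and] at ht
  exact h.crit_update hω c (by omega) fun hr => hv t (Prod.ext hr ht)

theorem MissesBot.sum_left_zero (h : MissesBot a b v (r + 1)) {ω : LauForm k a b n}
    (hω : ω.Kills) (hs : s ≠ 0) (hv : ∀ t, v t ≠ (r, s)) :
    ∑ t ∈ Finset.univ.filter (fun t => (v t).2 = s),
      crit ω c (Function.update v t ((v t).1 + 1, 0)) = 0 := by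
  refine Finset.sum_eq_zero fun t ht => ?_
  simp only [Finset.mem_filter, Finset.mem_univ, true_and] at ht
  exact h.crit_update hω c (by omega) fun hr => hv t (Prod.ext (by simpa using hr) ht)

theorem MissesBot.sum_eq (h : MissesBot a b v (r + 1)) (hω : EdgePair ω₀ ω₁ D₀ D₁)
    (hn : n = a * (b + 1)) (hc : 1 ≤ c) (hc' : c + 1 < a) (hs : 1 ≤ s) (hs' : s ≤ b) :
    ∑ t ∈ Finset.univ.filter (fun t => (v t).2 = s),
      crit ω₁ c (Function.update v t ((v t).1, 0)) =
    ∑ t ∈ Finset.univ.filter (fun t => (v t).2 = s),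
      crit ω₁ (c + 1) (Function.update v t ((v t).1 + 1, 0)) := by
  have := hω.sum_crit hn h.le h.nbot_eq hc hc' hs hs'
  rwa [Finset.sum_sub_distrib, sub_eq_zero] at this

end Rules

theorem Avoids.missesBot_update {u : Fin n → ℕ × ℕ} {E : Finset (ℕ × ℕ)} (h : Avoids a b u E)
    (hE : IsHoles a b E) (hn : n = a * (b + 1)) {t : Fin n} {r : ℕ} (ht : u t = (r + 1, 0))
    {P : ℕ × ℕ} (hP : P ∈ E) : MissesBot a b (Function.update u t P) (r + 1) := by
  have hb := hE.bounds P hP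
  have hr : r + 1 ≤ a := by simpa [ht] using (h.mem t).1
  refine ⟨update_injective (fun i j _ _ hij => h.inj hij) (fun i _ hi => (h.mem i).2.2.2 (hi ▸ hP)),
    ?_, by omega, hr, ?_, ?_⟩
  · intro t'
    by_cases h' : t' = t
    · subst h'; simpa using hb.2.2
    · simpa [h'] using (h.mem t').2.1
  · intro t' h0
    by_cases h' : t' = t
    · subst h'; simp at h0; omega
    · rw [Function.update_of_ne h'] at h0 ⊢
      obtain ⟨m1, -, m2, -⟩ := h.mem t'
      refine ⟨?_, m1, ?_⟩
      · by_contra h3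
        exact m2 (Prod.ext (by simpa using h3) h0)
      · intro h3
        exact h' (h.inj (by rw [ht]; exact Prod.ext h3 h0))
  · intro i h1 h2 h3
    obtain ⟨t', ht'⟩ := h.exists_eq hE hn (P := (i, 0)) h2 (by simp) (by simp; omega)
      (fun h4 => by have := (hE.bounds _ h4).2.1; simp at this)
    refine ⟨t', ?_⟩
    rw [Function.update_of_ne, ht']
    rintro rfl
    rw [ht] at ht'
    simp at ht'
    omega

/-- The critical coefficients vanish on tuples avoiding `E`. -/
def CritZero (ω : LauForm k a b n) (c : ℕ) (E : Finset (ℕ × ℕ)) : Prop :=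
  ∀ u : Fin n → ℕ × ℕ, Avoids a b u E → crit ω c u = 0

theorem Avoids.exists_bot {u : Fin n → ℕ × ℕ} {E : Finset (ℕ × ℕ)} (h : Avoids a b u E)
    (hE : IsHoles a b E) (hn : n = a * (b + 1)) {r : ℕ} (hr : r + 1 ≤ a) :
    ∃ t, u t = (r + 1, 0) :=
  h.exists_eq hE hn hr (by simp) (by simp) fun h4 => by
    have := (hE.bounds _ h4).2.1
    simp at this

theorem EdgePair.critZero_of_adjacent (h : EdgePair ω₀ ω₁ D₀ D₁) (hn : n = a * (b + 1))
    (ha : 3 ≤ a) {E : Finset (ℕ × ℕ)} (hE : IsHoles a b E) {r s c : ℕ} (h1 : (r, s) ∈ E)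
    (h2 : (r + 1, s) ∈ E) (hc : 1 ≤ c) (hc' : c < a) : CritZero ω₁ c E := by
  intro u hu
  obtain ⟨hb1, hb2, hb3⟩ := hE.bounds _ h2
  simp only at hb1 hb2 hb3
  obtain ⟨t, ht⟩ := hu.exists_bot hE hn hb1
  rcases lt_or_ge (c + 1) a with hca | hca
  · have hm := hu.missesBot_update hE hn ht h2
    have := hm.sum_eq h hn hc hca hb2 hb3
    rw [hm.sum_right h.kills₁ (by omega) (t := t) (by simp),
      hm.sum_left_zero h.kills₁ (by omega)] at this
    · rwa [Function.update_idem, ← ht, Function.update_eq_self] at this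
    · intro t'
      by_cases h' : t' = t
      · subst h'; simp
      · rw [Function.update_of_ne h']
        intro h3
        exact (hu.mem t').2.2.2 (h3 ▸ h1)
  · obtain ⟨c, rfl⟩ : ∃ c', c = c' + 1 := ⟨c - 1, by omega⟩
    have hm := hu.missesBot_update hE hn ht h1
    have := hm.sum_eq h hn (by omega) hc' hb2 hb3
    rw [hm.sum_left h.kills₁ (by omega) (t := t) (by simp),
      hm.sum_right_zero h.kills₁ (by omega)] at this
    · rw [Function.update_idem, ← ht, Function.update_eq_self] at this
      exact this.symm
    · intro t'
      by_cases h' : t' = t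
      · subst h'; simp
      · rw [Function.update_of_ne h']
        intro h3
        exact (hu.mem t').2.2.2 (h3 ▸ h2)

/-- Replacing a point `P` of a tuple (at `t'`) and freeing `P`, filling the hole `Q` (at `t`). -/
theorem Avoids.exchange {u : Fin n → ℕ × ℕ} {E E' : Finset (ℕ × ℕ)} (h : Avoids a b u E)
    (hE : IsHoles a b E) (hE' : IsHoles a b E') {t t' : Fin n} {r : ℕ} {P Q : ℕ × ℕ}
    (ht : u t = (r + 1, 0)) (ht' : u t' = P) (hP : 1 ≤ P.2) (hQ : Q ∈ E) (hQ' : Q ∉ E')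
    (hsub : ∀ X ∈ E', X ∈ E ∨ X = P) :
    Avoids a b (Function.update (Function.update u t Q) t' (r + 1, 0)) E' := by
  have hb := hE.bounds Q hQ
  have hne : t' ≠ t := by
    rintro rfl
    rw [ht] at ht'
    rw [← ht'] at hP
    simp at hP
  constructor
  · refine update_injective (fun i j hi hj hij => ?_) (fun i hi => ?_)
    · exact update_injective (fun i j _ _ hij => h.inj hij)
        (fun i _ hi => (h.mem i).2.2.2 (hi ▸ hQ)) hij
    · by_cases hit : i = t
      · subst hit
        rw [Function.update_self]
        rintro rfl
        simp at hb
      · rw [Function.update_of_ne hit, ← ht]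
        exact fun h' => hit (h.inj h')
  · intro i
    by_cases hi : i = t'
    · subst hi
      rw [Function.update_self]
      refine ⟨by simpa [ht] using (h.mem t).1, by simp, by simp, fun h' => ?_⟩
      have := (hE'.bounds _ h').2.1
      simp at this
    · rw [Function.update_of_ne hi]
      by_cases hit : i = t
      · subst hit
        rw [Function.update_self]
        refine ⟨hb.1, hb.2.2, ?_, hQ'⟩
        rintro rfl
        simp at hb
      · rw [Function.update_of_ne hit]
        obtain ⟨m1, m2, m3, m4⟩ := h.mem i
        refine ⟨m1, m2, m3, fun h' => ?_⟩
        rcases hsub _ h' with h'' | h''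
        · exact m4 h''
        · exact hi (h.inj (h''.trans ht'.symm))

theorem IsHoles.exchange {E : Finset (ℕ × ℕ)} (hE : IsHoles a b E) {P Q : ℕ × ℕ}
    (hP : P ∈ E) (hQ : Q ∉ E) (hQ' : Q.1 ≤ a ∧ 1 ≤ Q.2 ∧ Q.2 ≤ b) :
    IsHoles a b (insert Q (E.erase P)) := by
  constructor
  · intro X hX
    rcases Finset.mem_insert.mp hX with rfl | hX
    · exact hQ'
    · exact hE.bounds X (Finset.mem_of_mem_erase hX)
  · rw [Finset.card_insert_of_notMem (fun h => hQ (Finset.mem_of_mem_erase h)),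
      Finset.card_erase_add_one hP, hE.card_eq]

theorem EdgePair.critZero_lower (h : EdgePair ω₀ ω₁ D₀ D₁) (hn : n = a * (b + 1))
    {E E' : Finset (ℕ × ℕ)} (hE : IsHoles a b E) (hE' : IsHoles a b E') {r s c : ℕ}
    (h1 : (r + 1, s) ∈ E) (h2 : (r, s) ∉ E) (h1' : (r + 1, s) ∉ E') (h2' : (r, s) ∈ E')
    (hsub : ∀ X ∈ E, X ∈ E' ∨ X = (r + 1, s)) (hsub' : ∀ X ∈ E', X ∈ E ∨ X = (r, s))
    (hc : 1 ≤ c) (hc' : c + 1 < a) :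
    CritZero ω₁ c E ↔ CritZero ω₁ (c + 1) E' := by
  obtain ⟨hb1, hb2, hb3⟩ := hE.bounds _ h1
  simp only at hb1 hb2 hb3
  constructor
  · intro hz u hu
    obtain ⟨t, ht⟩ := hu.exists_bot hE' hn hb1
    obtain ⟨t', ht'⟩ := hu.exists_eq hE' hn hb1 hb3 (by simp) h1'
    have hne : t' ≠ t := by
      rintro rfl
      rw [ht] at ht'
      simp at ht'
      omega
    have hm := hu.missesBot_update hE' hn ht h2'
    have := hm.sum_eq h hn hc hc' hb2 hb3
    rw [hm.sum_left h.kills₁ (by omega) (t := t) (by simp),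
      hm.sum_right h.kills₁ (by omega) (t := t') (by rw [Function.update_of_ne hne, ht']),
      hz _ (hu.exchange hE' hE ht ht' hb2 h2' h2 hsub), Function.update_idem, ← ht,
      Function.update_eq_self] at this
    exact this.symm
  · intro hz u hu
    obtain ⟨t, ht⟩ := hu.exists_bot hE hn hb1
    obtain ⟨t', ht'⟩ := hu.exists_eq hE hn (P := (r, s)) (by simp; omega) hb3 (by simp; omega) h2
    have hne : t' ≠ t := by
      rintro rfl
      rw [ht] at ht'
      simp at ht'
    have hm := hu.missesBot_update hE hn ht h1
    have := hm.sum_eq h hn hc hc' hb2 hb3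
    rw [hm.sum_right h.kills₁ (by omega) (t := t) (by simp),
      hm.sum_left h.kills₁ (by omega) (t := t') (by rw [Function.update_of_ne hne, ht']),
      hz _ (hu.exchange hE hE' ht ht' hb2 h1 h1' hsub'), Function.update_idem, ← ht,
      Function.update_eq_self] at this
    exact this

end Holes

section Connect

variable {k : Type*} [Field k] {a b n : ℕ} {ω₀ ω₁ D₀ D₁ : LauForm k a b n}

theorem EdgePair.critZero_of_same_column (h : EdgePair ω₀ ω₁ D₀ D₁) (hn : n = a * (b + 1))
    (ha : 3 ≤ a) (d : ℕ) : ∀ {E : Finset (ℕ × ℕ)}, IsHoles a b E → ∀ {i s c : ℕ}, (i, s) ∈ E →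
    (i + d + 1, s) ∈ E → 1 ≤ c → c < a → CritZero ω₁ c E := by
  classical
  induction d with
  | zero =>
    intro E hE i s c h1 h2
    exact h.critZero_of_adjacent hn ha hE h1 h2
  | succ d ih =>
    intro E hE i s c h1 h2 hc hc'
    obtain ⟨hb1, hb2, hb3⟩ := hE.bounds _ h2
    simp only at hb1 hb2 hb3
    by_cases h3 : (i + d + 1, s) ∈ E
    · exact h.critZero_of_adjacent hn ha hE h3 h2 hc hc'
    by_cases h4 : (i + 1, s) ∈ E
    · exact h.critZero_of_adjacent hn ha hE h1 h4 hc hc'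
    rcases lt_or_ge (c + 1) a with hca | hca
    · have hE' := hE.exchange (Q := (i + d + 1, s)) h2 h3 ⟨by simp; omega, hb2, hb3⟩
      refine (h.critZero_lower hn hE hE' h2 h3 ?_ (Finset.mem_insert_self _ _) ?_ ?_ hc hca).mpr
        (ih hE' (i := i) (s := s) ?_ (Finset.mem_insert_self _ _) (by omega) (by omega))
      · simp
      · intro X hX
        by_cases hX' : X = (i + (d + 1) + 1, s)
        · exact Or.inr hX'
        · exact Or.inl (Finset.mem_insert_of_mem (Finset.mem_erase.mpr ⟨hX', hX⟩))
      · intro X hX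
        rcases Finset.mem_insert.mp hX with hX | hX
        · exact Or.inr hX
        · exact Or.inl (Finset.mem_of_mem_erase hX)
      · exact Finset.mem_insert_of_mem (Finset.mem_erase.mpr ⟨by simp; omega, h1⟩)
    · obtain ⟨c, rfl⟩ : ∃ c', c = c' + 1 := ⟨c - 1, by omega⟩
      have hE' := hE.exchange (Q := (i + 1, s)) h1 h4 ⟨by simp; omega, hb2, hb3⟩
      refine (h.critZero_lower hn hE' hE (Finset.mem_insert_self _ _) ?_ h4 h1 ?_ ?_ (by omega)
        hc').mp (ih hE' (i := i + 1) (s := s) (Finset.mem_insert_self _ _) ?_ (by omega) (by omega))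
      · simp
      · intro X hX
        rcases Finset.mem_insert.mp hX with hX | hX
        · exact Or.inr hX
        · exact Or.inl (Finset.mem_of_mem_erase hX)
      · intro X hX
        by_cases hX' : X = (i, s)
        · exact Or.inr hX'
        · exact Or.inl (Finset.mem_insert_of_mem (Finset.mem_erase.mpr ⟨hX', hX⟩))
      · refine Finset.mem_insert_of_mem (Finset.mem_erase.mpr ⟨by simp; omega, ?_⟩)
        rwa [show i + 1 + d + 1 = i + (d + 1) + 1 by omega]

/-- The holes given by one height in each column. -/
def graphHoles (b : ℕ) (h : ℕ → ℕ) : Finset (ℕ × ℕ) :=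
  (Finset.Icc 1 b).image fun s => (h s, s)

theorem mem_graphHoles {f : ℕ → ℕ} {P : ℕ × ℕ} :
    P ∈ graphHoles b f ↔ (1 ≤ P.2 ∧ P.2 ≤ b) ∧ P.1 = f P.2 := by
  simp only [graphHoles, Finset.mem_image, Finset.mem_Icc]
  constructor
  · rintro ⟨s, hs, rfl⟩
    exact ⟨hs, rfl⟩
  · rintro ⟨hs, h⟩
    exact ⟨P.2, hs, Prod.ext h.symm rfl⟩

theorem isHoles_graphHoles {f : ℕ → ℕ} (hf : ∀ s ∈ Finset.Icc 1 b, f s ≤ a) :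
    IsHoles a b (graphHoles b f) := by
  constructor
  · intro P hP
    rw [mem_graphHoles] at hP
    exact ⟨hP.2 ▸ hf _ (Finset.mem_Icc.mpr hP.1), hP.1⟩
  · rw [graphHoles, Finset.card_image_of_injective _ (fun s t h => (Prod.mk.inj h).2)]
    simp

theorem IsHoles.exists_eq_graphHoles {E : Finset (ℕ × ℕ)} (hE : IsHoles a b E)
    (hinj : ∀ i j s, (i, s) ∈ E → (j, s) ∈ E → i = j) :
    ∃ f : ℕ → ℕ, (∀ s ∈ Finset.Icc 1 b, f s ≤ a) ∧ E = graphHoles b f := by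
  classical
  have himg : E.image Prod.snd = Finset.Icc 1 b := by
    refine Finset.eq_of_subset_of_card_le ?_ ?_
    · intro s hs
      obtain ⟨P, hP, rfl⟩ := Finset.mem_image.mp hs
      exact Finset.mem_Icc.mpr (hE.bounds P hP).2
    · rw [Finset.card_image_of_injOn, hE.card_eq]
      · simp
      · rintro ⟨i, s⟩ h1 ⟨j, t⟩ h2 heq
        obtain rfl : s = t := heq
        rw [hinj i j s h1 h2]
  have hex : ∀ s, ∃ i, s ∈ Finset.Icc 1 b → (i, s) ∈ E := by
    intro s
    by_cases hs : s ∈ Finset.Icc 1 b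
    · obtain ⟨⟨i, s'⟩, hP, rfl⟩ := Finset.mem_image.mp (himg ▸ hs)
      exact ⟨i, fun _ => hP⟩
    · exact ⟨0, fun h => absurd h hs⟩
  choose f hf using hex
  refine ⟨f, fun s hs => (hE.bounds _ (hf s hs)).1, ?_⟩
  ext ⟨i, s⟩
  rw [mem_graphHoles]
  constructor
  · intro h1
    have hs := (hE.bounds _ h1).2
    exact ⟨hs, hinj _ _ s h1 (hf s (Finset.mem_Icc.mpr hs))⟩
  · rintro ⟨hs, h1⟩
    simp only at h1 hs
    rw [h1]
    exact hf s (Finset.mem_Icc.mpr hs)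

theorem EdgePair.critZero_graphHoles_lower (h : EdgePair ω₀ ω₁ D₀ D₁) (hn : n = a * (b + 1))
    {f g : ℕ → ℕ} (hf : ∀ s ∈ Finset.Icc 1 b, f s ≤ a) (hg : ∀ s ∈ Finset.Icc 1 b, g s ≤ a)
    {s c : ℕ} (hs : s ∈ Finset.Icc 1 b) (hfg : f s = g s + 1) (hfg' : ∀ t, t ≠ s → f t = g t)
    (hc : 1 ≤ c) (hc' : c + 1 < a) :
    CritZero ω₁ c (graphHoles b f) ↔ CritZero ω₁ (c + 1) (graphHoles b g) := by
  have hs' := Finset.mem_Icc.mp hs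
  refine h.critZero_lower hn (isHoles_graphHoles hf) (isHoles_graphHoles hg) (r := g s) (s := s)
    ?_ ?_ ?_ ?_ ?_ ?_ hc hc'
  · exact mem_graphHoles.mpr ⟨hs', hfg.symm⟩
  · rw [mem_graphHoles]
    rintro ⟨-, h1⟩
    simp only at h1
    omega
  · rw [mem_graphHoles]
    rintro ⟨-, h1⟩
    simp only at h1
    omega
  · exact mem_graphHoles.mpr ⟨hs', rfl⟩
  · rintro ⟨i, t⟩ hX
    rw [mem_graphHoles] at hX ⊢
    by_cases ht : t = s
    · subst ht
      exact Or.inr (Prod.ext (hX.2.trans hfg) rfl)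
    · exact Or.inl ⟨hX.1, hX.2.trans (hfg' t ht)⟩
  · rintro ⟨i, t⟩ hX
    rw [mem_graphHoles] at hX ⊢
    by_cases ht : t = s
    · subst ht
      exact Or.inr (Prod.ext hX.2 rfl)
    · exact Or.inl ⟨hX.1, hX.2.trans (hfg' t ht).symm⟩

/-- The `ℓ¹`-distance of two height functions. -/
def hdist (b : ℕ) (f g : ℕ → ℕ) : ℕ := ∑ s ∈ Finset.Icc 1 b, ((f s - g s) + (g s - f s))

theorem hdist_update {f g : ℕ → ℕ} {s y : ℕ} (hs : s ∈ Finset.Icc 1 b)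
    (hy : (y - g s) + (g s - y) < (f s - g s) + (g s - f s)) :
    hdist b (Function.update f s y) g < hdist b f g := by
  classical
  refine Finset.sum_lt_sum (fun t _ => ?_) ⟨s, hs, by simpa using hy⟩
  by_cases ht : t = s
  · subst ht; simpa using hy.le
  · simp [ht]

theorem sum_update_Icc {f : ℕ → ℕ} {s y : ℕ} (hs : s ∈ Finset.Icc 1 b) :
    ∑ t ∈ Finset.Icc 1 b, Function.update f s y t + f s = ∑ t ∈ Finset.Icc 1 b, f t + y := by
  classical
  rw [← Finset.add_sum_erase _ _ hs, ← Finset.add_sum_erase _ f hs, Function.update_self]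
  have : ∑ t ∈ (Finset.Icc 1 b).erase s, Function.update f s y t
      = ∑ t ∈ (Finset.Icc 1 b).erase s, f t :=
    Finset.sum_congr rfl fun t ht => by simp [Finset.ne_of_mem_erase ht]
  rw [this]
  ring

/-- Configurations of the same total weight are equivalent. -/
theorem EdgePair.critZero_of_weight_eq (h : EdgePair ω₀ ω₁ D₀ D₁) (hn : n = a * (b + 1))
    (ha : 3 ≤ a) {g : ℕ → ℕ} (hg : ∀ s ∈ Finset.Icc 1 b, g s ≤ a) {c' : ℕ} (hc1' : 1 ≤ c')
    (hc2' : c' < a) (hz : CritZero ω₁ c' (graphHoles b g)) (D : ℕ) : ∀ {f : ℕ → ℕ},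
    (∀ s ∈ Finset.Icc 1 b, f s ≤ a) → ∀ {c : ℕ}, 1 ≤ c → c < a →
    c + ∑ s ∈ Finset.Icc 1 b, f s = c' + ∑ s ∈ Finset.Icc 1 b, g s → hdist b f g = D →
    CritZero ω₁ c (graphHoles b f) := by
  classical
  induction D using Nat.strong_induction_on with
  | _ D ih =>
  intro f hf c hc1 hc2 hw hD
  by_cases hlo : c + 1 < a ∧ ∃ s ∈ Finset.Icc 1 b, g s < f s
  · obtain ⟨hca, s, hs, hlt⟩ := hlo
    have hf' : ∀ t ∈ Finset.Icc 1 b, Function.update f s (f s - 1) t ≤ a := by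
      intro t ht
      have := hf t ht
      by_cases hts : t = s
      · subst hts; simp; omega
      · simpa [hts] using this
    have hsum := sum_update_Icc (f := f) (y := f s - 1) hs
    rw [h.critZero_graphHoles_lower hn hf hf' hs (by simp; omega)
      (fun t ht => by simp [ht]) hc1 hca]
    exact ih _ (hD ▸ hdist_update hs (by omega)) hf' (by omega) hca (by omega) rfl
  by_cases hhi : 2 ≤ c ∧ ∃ s ∈ Finset.Icc 1 b, f s < g s
  · obtain ⟨hca, s, hs, hlt⟩ := hhi
    obtain ⟨c, rfl⟩ : ∃ c', c = c' + 1 := ⟨c - 1, by omega⟩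
    have hf' : ∀ t ∈ Finset.Icc 1 b, Function.update f s (f s + 1) t ≤ a := by
      intro t ht
      have := hf t ht
      have := hg t ht
      by_cases hts : t = s
      · subst hts; simp; omega
      · simpa [hts] using hf t ht
    have hsum := sum_update_Icc (f := f) (y := f s + 1) hs
    rw [← h.critZero_graphHoles_lower hn hf' hf hs (by simp)
      (fun t ht => by simp [ht]) (by omega) hc2]
    exact ih _ (hD ▸ hdist_update hs (by omega)) hf' (by omega) (by omega) (by omega) rfl
  have hsums : ((∀ s ∈ Finset.Icc 1 b, f s ≤ g s) ∧
        ∑ s ∈ Finset.Icc 1 b, g s ≤ ∑ s ∈ Finset.Icc 1 b, f s) ∨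
      ((∀ s ∈ Finset.Icc 1 b, g s ≤ f s) ∧
        ∑ s ∈ Finset.Icc 1 b, f s ≤ ∑ s ∈ Finset.Icc 1 b, g s) := by
    push Not at hlo hhi
    by_cases h1 : c = 1
    · exact Or.inl ⟨hlo (by omega), by omega⟩
    · by_cases h2 : c + 1 < a
      · refine Or.inl ⟨hlo h2, Finset.sum_le_sum (hhi (by omega))⟩
      · exact Or.inr ⟨hhi (by omega), by omega⟩
  have hfg : ∀ s ∈ Finset.Icc 1 b, f s = g s := by
    rcases hsums with ⟨h1, h2⟩ | ⟨h1, h2⟩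
    · exact (Finset.sum_eq_sum_iff_of_le h1).mp (le_antisymm (Finset.sum_le_sum h1) h2)
    · exact fun s hs =>
        ((Finset.sum_eq_sum_iff_of_le h1).mp (le_antisymm (Finset.sum_le_sum h1) h2) s hs).symm
  have hsum : ∑ s ∈ Finset.Icc 1 b, f s = ∑ s ∈ Finset.Icc 1 b, g s :=
    Finset.sum_congr rfl hfg
  have : graphHoles b f = graphHoles b g := by
    ext P
    rw [mem_graphHoles, mem_graphHoles]
    constructor <;> rintro ⟨hs, h1⟩ <;> refine ⟨hs, ?_⟩ <;>
      simpa [hfg _ (Finset.mem_Icc.mpr hs)] using h1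
  rw [this, show c = c' by omega]
  exact hz

/-- A tuple on which a form does not obviously vanish avoids the set of the points it misses. -/
theorem exists_isHoles {u : Fin n → ℕ × ℕ} (hn : n = a * (b + 1)) (hu : Function.Injective u)
    (hmem : ∀ t, (u t).1 ≤ a ∧ (u t).2 ≤ b ∧ u t ≠ (0, 0)) (hbot : nbot u = a) :
    ∃ E, IsHoles a b E ∧ Avoids a b u E := by
  classical
  let S := (Finset.range (a + 1) ×ˢ Finset.range (b + 1)).erase (0, 0)
  have hS : ∀ Q, Q ∈ S ↔ Q.1 ≤ a ∧ Q.2 ≤ b ∧ Q ≠ (0, 0) := by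
    intro Q
    simp only [S, Finset.mem_erase, Finset.mem_product, Finset.mem_range, Nat.lt_succ_iff]
    tauto
  have hsub : Finset.univ.image u ⊆ S := by
    intro Q hQ
    obtain ⟨t, -, rfl⟩ := Finset.mem_image.mp hQ
    exact (hS _).mpr (hmem t)
  refine ⟨S \ Finset.univ.image u, ⟨fun P hP => ?_, ?_⟩, hu, fun t => ?_⟩
  · obtain ⟨h1, h2⟩ := Finset.mem_sdiff.mp hP
    obtain ⟨h3, h4, h5⟩ := (hS P).mp h1
    refine ⟨h3, ?_, h4⟩
    by_contra h6
    have h6 : P.2 = 0 := by omega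
    apply h2
    have himg : (Finset.univ.filter fun t => (u t).2 = 0).image (fun t => (u t).1)
        = Finset.Icc 1 a := by
      refine Finset.eq_of_subset_of_card_le ?_ ?_
      · intro i hi
        obtain ⟨t, ht, rfl⟩ := Finset.mem_image.mp hi
        simp only [Finset.mem_filter, Finset.mem_univ, true_and] at ht
        obtain ⟨m1, -, m2⟩ := hmem t
        refine Finset.mem_Icc.mpr ⟨?_, m1⟩
        by_contra h7
        exact m2 (Prod.ext (by simpa using h7) ht)
      · rw [Finset.card_image_of_injOn, Nat.card_Icc]
        · unfold nbot at hbot; omega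
        · intro t ht t' ht' heq
          simp only [Finset.coe_filter, Finset.mem_univ, true_and, Set.mem_ofPred_eq] at ht ht'
          exact hu (Prod.ext heq (ht.trans ht'.symm))
    have hP1 : P.1 ∈ Finset.Icc 1 a := by
      refine Finset.mem_Icc.mpr ⟨?_, h3⟩
      by_contra h7
      exact h5 (Prod.ext (by simpa using h7) h6)
    rw [← himg] at hP1
    obtain ⟨t, ht, hP1⟩ := Finset.mem_image.mp hP1
    simp only [Finset.mem_filter, Finset.mem_univ, true_and] at ht
    exact Finset.mem_image.mpr ⟨t, Finset.mem_univ t, Prod.ext hP1 (ht.trans h6.symm)⟩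
  · rw [Finset.card_sdiff_of_subset hsub, Finset.card_image_of_injective _ hu, Finset.card_fin,
      Finset.card_erase_of_mem (by simp), Finset.card_product, Finset.card_range,
      Finset.card_range]
    have : (a + 1) * (b + 1) = a * (b + 1) + b + 1 := by ring
    omega
  · obtain ⟨m1, m2, m3⟩ := hmem t
    exact ⟨m1, m2, m3, fun h => (Finset.mem_sdiff.mp h).2
      (Finset.mem_image_of_mem u (Finset.mem_univ t))⟩

theorem Avoids.critZero {ω : LauForm k a b n} {u : Fin n → ℕ × ℕ} {E : Finset (ℕ × ℕ)}
    (h : Avoids a b u E) (hE : IsHoles a b E) (hn : n = a * (b + 1)) {c : ℕ}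
    (h0 : crit ω c u = 0) : CritZero ω c E := by
  intro u' hu'
  have key := ω.coeff_eq_zero_of_range_eq (nb k a b) hu'.inj (u₀ := u) (d := (-(c : ℤ), 0))
    (fun j => by
      obtain ⟨m1, m2, m3, m4⟩ := hu'.mem j
      exact h.exists_eq hE hn m1 m2 m3 m4)
  have hmixed : ∀ v : Fin n → ℕ × ℕ, mixed k a b v ∅ = fun j => nb k a b (v j) :=
    fun v => funext fun j => by simp [mixed]
  rw [crit, hmixed] at h0 ⊢
  exact key h0

/-- Representatives of the weights suffice to detect the vanishing of all critical
coefficients. -/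
theorem exists_critical_tests (k : Type*) [Field k] (a b n p : ℕ) (ha : 3 ≤ a)
    (hn : n = a * (b + 1)) (hp : p + 1 = n) :
    ∃ (c : Fin p → ℕ) (U : Fin p → Fin n → ℕ × ℕ), ∀ ω₀ ω₁ D₀ D₁ : LauForm k a b n,
      EdgePair ω₀ ω₁ D₀ D₁ → (∀ w, crit ω₁ (c w) (U w) = 0) → ∀ m, BotVanish ω₁ m := by
  classical
  have hex : ∀ w : Fin p, ∃ (c : ℕ) (U : Fin n → ℕ × ℕ),
      (∃ (c : ℕ) (f : ℕ → ℕ) (u : Fin n → ℕ × ℕ), 1 ≤ c ∧ c < a ∧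
        (∀ s ∈ Finset.Icc 1 b, f s ≤ a) ∧ Avoids a b u (graphHoles b f) ∧
        c + ∑ s ∈ Finset.Icc 1 b, f s = w + 1) →
      1 ≤ c ∧ c < a ∧ ∃ f : ℕ → ℕ, (∀ s ∈ Finset.Icc 1 b, f s ≤ a) ∧
        Avoids a b U (graphHoles b f) ∧ c + ∑ s ∈ Finset.Icc 1 b, f s = w + 1 := by
    intro w
    by_cases h : ∃ (c : ℕ) (f : ℕ → ℕ) (u : Fin n → ℕ × ℕ), 1 ≤ c ∧ c < a ∧
        (∀ s ∈ Finset.Icc 1 b, f s ≤ a) ∧ Avoids a b u (graphHoles b f) ∧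
        c + ∑ s ∈ Finset.Icc 1 b, f s = w + 1
    · obtain ⟨c, f, u, h1, h2, h3, h4, h5⟩ := h
      exact ⟨c, u, fun _ => ⟨h1, h2, f, h3, h4, h5⟩⟩
    · exact ⟨0, fun _ => 0, fun h' => absurd h' h⟩
  choose c U hcU using hex
  refine ⟨c, U, fun ω₀ ω₁ D₀ D₁ h hz => h.botVanish hn (h.botVanish_of_crit hn ?_)⟩
  intro u hu hbot c₁ hc₁ hc₁'
  have hzero : ω₁ (mixed k a b u ∅) = 0 → crit ω₁ c₁ u = 0 := fun h0 => by
    rw [crit, h0]; rfl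
  by_cases hinj : Function.Injective u
  swap
  · obtain ⟨i, j, hij, hne⟩ := Function.not_injective_iff.mp hinj
    exact hzero (ω₁.map_eq_zero_of_eq _ (by simp [mixed, hij]) hne)
  by_cases h0 : ∃ t, u t = (0, 0)
  · obtain ⟨t, ht⟩ := h0
    exact hzero (h.kills₁.apply_mixed_of_eq ht)
  by_cases h1 : ∃ t, a < (u t).1
  · obtain ⟨t, ht⟩ := h1
    refine hzero (ω₁.map_coord_zero t ?_)
    ext1 Q
    have := Q.1.isLt
    simp only [mixed, nb, Finset.notMem_empty, if_false, Pi.zero_apply]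
    split_ifs
    · rw [gv_eq_zero ht]; rfl
    · simp only [fv]
      rw [if_neg (by omega)]
  push Not at h0 h1
  obtain ⟨E, hE, hav⟩ := exists_isHoles hn hinj (fun t => ⟨h1 t, hu t, h0 t⟩) hbot
  by_cases hcol : ∃ i j s, (i, s) ∈ E ∧ (j, s) ∈ E ∧ i < j
  · obtain ⟨i, j, s, hi, hj, hij⟩ := hcol
    obtain ⟨d, rfl⟩ := Nat.exists_eq_add_of_lt hij
    exact h.critZero_of_same_column hn ha d hE hi hj hc₁ hc₁' u hav
  push Not at hcol
  obtain ⟨f, hf, rfl⟩ := hE.exists_eq_graphHoles (fun i j s hi hj =>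
    le_antisymm (hcol _ _ _ hj hi) (hcol _ _ _ hi hj))
  have hle : ∑ s ∈ Finset.Icc 1 b, f s ≤ b * a := by
    refine (Finset.sum_le_card_nsmul _ _ _ hf).trans ?_
    simp
  have hw : c₁ + ∑ s ∈ Finset.Icc 1 b, f s - 1 < p := by
    have : a * (b + 1) = b * a + a := by ring
    omega
  obtain ⟨g1, g2, g, hg, gav, gw⟩ := hcU ⟨_, hw⟩ ⟨c₁, f, u, hc₁, hc₁', hf, hav, by simp; omega⟩
  refine h.critZero_of_weight_eq hn ha hg g1 g2
    (gav.critZero (isHoles_graphHoles hg) hn (hz ⟨_, hw⟩)) _ hf hc₁ hc₁' ?_ rfl u hav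
  rw [gw]
  simp only
  omega

end Connect

section Lifts

variable {k : Type*} [Field k] {a b n : ℕ}

theorem LauForm.kills_of_vecCons {ω : LauForm k a b (n + 1)}
    (h : ∀ ψ, ω (Matrix.vecCons ev ψ) = 0) : ω.Kills := by
  intro v t ht
  rw [← Fin.insertNth_self_removeNth t v, AlternatingMap.map_insertNth, ht, h, smul_zero]

/-- The exponent of the monomial attached to a lattice point. -/
def gridExp (Q : Grid a b) : ℤ × ℤ := ((Q.1 : ℤ), (Q.2 : ℤ))

theorem ev_apply (Q : Grid a b) : (ev : Vec k a b) Q = mon k (gridExp Q) := by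
  simp [ev, gv, gridExp]

/-- Exterior multiplication by the `Q`-th coordinate, divided by the monomial of `Q`. -/
def lift (Q : Grid a b) : LauForm k a b n →ₗ[k] LauForm k a b (n + 1) where
  toFun x := mon k (-gridExp Q) •
    AlternatingMap.alternatizeUncurryFin ((LinearMap.proj Q).smulRight x)
  map_add' x y := by
    ext v
    simp [AlternatingMap.alternatizeUncurryFin_apply, Finset.sum_add_distrib, mul_add]
  map_smul' c x := by
    ext v
    simp [AlternatingMap.alternatizeUncurryFin_apply, Finset.smul_sum, smul_comm c]

theorem lift_apply (Q : Grid a b) (x : LauForm k a b n) (v : Fin (n + 1) → Vec k a b) :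
    lift Q x v = mon k (-gridExp Q) *
      ∑ i : Fin (n + 1), (-1) ^ (i : ℕ) * (v i Q * x (i.removeNth v)) := by
  simp [lift, AlternatingMap.alternatizeUncurryFin_apply]

theorem lift_vecCons_ev (Q : Grid a b) {x : LauForm k a b n} (hx : x.Kills)
    (ψ : Fin n → Vec k a b) : lift Q x (Matrix.vecCons ev ψ) = x ψ := by
  rw [lift_apply, Fin.sum_univ_succ, Finset.sum_eq_zero, add_zero]
  · have : Fin.removeNth 0 (Matrix.vecCons ev ψ) = ψ := by
      funext j; simp [Fin.removeNth_apply]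
    rw [this]
    simp only [Fin.val_zero, pow_zero, one_mul, Matrix.cons_val_zero, ev_apply]
    rw [← mul_assoc, mon_mul_mon, neg_add_cancel, mon_zero, one_mul]
  · intro i _
    have : NeZero n := ⟨by rintro rfl; exact i.elim0⟩
    rw [hx _ 0, mul_zero, mul_zero]
    simp [Fin.removeNth_apply]

theorem lift_stdLE (Q : Grid a b) {x : LauForm k a b n} {ℓ : ℤ × ℤ →+ ℤ} {m : ℤ}
    (hx : x.StdLE ℓ m) : (lift Q x).StdLE ℓ (m - ℓ (gridExp Q)) := by
  intro u
  rw [lift_apply]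
  have : m - ℓ (gridExp Q) = ℓ (-gridExp Q) + m := by rw [map_neg]; ring
  rw [this]
  refine DegLE.mul (DegLE.mon_mem le_rfl) (Submodule.sum_mem _ fun i _ => ?_)
  have h1 : (stdv (u i) : Vec k a b) Q * x (i.removeNth fun j => stdv (u j)) ∈ DegLE ℓ m := by
    rw [stdv_apply]
    split_ifs
    · rw [one_mul]; exact hx (fun j => u (i.succAbove j))
    · rw [zero_mul]; exact zero_mem _
  rcases neg_one_pow_eq_or (Lau k) (i : ℕ) with h | h <;> rw [h]
  · rwa [one_mul]
  · rw [neg_one_mul]; exact neg_mem h1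

/-- Keep the coefficients whose exponent satisfies a predicate. -/
def trunc (S : ℤ × ℤ → Prop) [DecidablePred S] : Lau k →+ Lau k where
  toFun f := AddMonoidAlgebra.ofCoeff (f.coeff.filter S)
  map_zero' := by ext d; simp [Finsupp.filter_apply]
  map_add' f g := by
    ext d
    simp only [AddMonoidAlgebra.coeff_add, Finsupp.filter_add]

theorem trunc_coeff (S : ℤ × ℤ → Prop) [DecidablePred S] (f : Lau k) (d : ℤ × ℤ) :
    (trunc S f).coeff d = if S d then f.coeff d else 0 := Finsupp.filter_apply S f.coeff d

theorem trunc_mem_degLE (S : ℤ × ℤ → Prop) [DecidablePred S] {f : Lau k} {ℓ : ℤ × ℤ →+ ℤ}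
    {m : ℤ} (hf : f ∈ DegLE ℓ m) : trunc S f ∈ DegLE ℓ m := by
  intro d hd
  rw [trunc_coeff, hf d hd, ite_self]

/-- If no coefficients of the values of `ω` obstruct it, then `ω` decomposes into a part of
nonnegative and a part of nonpositive horizontal degree. -/
theorem LauForm.exists_nonneg_part {B : Grid a b → Vec k a b} (hev : B (0, 0) = ev)
    (hx1 : ∀ P, stdv P ∈ WSpan B xdeg (fun P => if (P.2 : ℕ) = 0 then 1 else 0))
    (hx0 : ∀ P, stdv P ∈ WSpan B (-xdeg) (fun _ => 0))
    {ℓ : ℤ × ℤ →+ ℤ} {w : Grid a b → ℤ} (hw : ∀ P, stdv P ∈ WSpan B ℓ w)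
    {ω : LauForm k a b (n + 1)} (hk : ω.Kills)
    (hdeg : ∀ u : Fin (n + 1) → Grid a b, ω (fun j => B (u j)) ∈ DegLE ℓ (0 - ∑ j, w (u j)))
    (hvan : ∀ (u : Fin (n + 1) → Grid a b) (c : ℕ) (σ : ℤ), 1 ≤ c →
      c < nbot (fun t => ((u t).1.val, (u t).2.val)) →
      (ω (fun j => B (u j))).coeff (-c, σ) = 0) :
    ∃ ω' : LauForm k a b (n + 1), ω'.Kills ∧ ω'.StdLE (-xdeg) 0 ∧ (ω' - ω).StdLE xdeg 0 ∧
      ω'.StdLE ℓ 0 := by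
  obtain ⟨β, hβ⟩ := exists_basis hw
  obtain ⟨ω', hω'⟩ := LauForm.exists_compose β (trunc fun d => 0 ≤ d.1) ω
  simp only [hβ] at hω'
  refine ⟨ω', ?_, stdLE_of_wspan hx0 fun u => ?_, stdLE_of_wspan hx1 fun u => ?_,
    stdLE_of_wspan hw fun u => ?_⟩
  · refine kills_of_vecCons fun ψ => ?_
    have : ω'.curryLeft ev = 0 := by
      refine β.ext_alternating fun v _ => ?_
      rw [AlternatingMap.curryLeft_apply_apply, AlternatingMap.zero_apply]
      have e : (Matrix.vecCons ev (fun i => β (v i)) : Fin (n + 1) → Vec k a b)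
          = fun j => B (Matrix.vecCons (0, 0) v j) := by
        funext j
        refine Fin.cases ?_ (fun j => ?_) j
        · simp [hev]
        · simp [hβ]
      rw [e, hω', hk _ 0 (by simp [hev]), map_zero]
    rw [← AlternatingMap.curryLeft_apply_apply, this, AlternatingMap.zero_apply]
  · rw [hω']
    intro d hd
    rw [trunc_coeff, if_neg]
    simp at hd
    omega
  · rw [AlternatingMap.sub_apply, hω']
    intro d hd
    rw [AddMonoidAlgebra.coeff_sub, Finsupp.sub_apply, trunc_coeff]
    split_ifs with h
    · exact sub_self _
    · have hs := sum_bot (fun t => ((u t).1.val, (u t).2.val)) 1 0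
      simp only [mul_one, mul_zero, add_zero] at hs
      rw [hs] at hd
      simp at hd
      have := hvan u (-d.1).toNat d.2 (by omega) (by omega)
      rw [Int.toNat_of_nonneg (by omega), neg_neg] at this
      rw [this, sub_zero]
  · rw [hω']
    exact trunc_mem_degLE _ (hdeg u)

/-- The conditions satisfied by the forms attached to Koszul cocycles. -/
structure LauForm.IsCocycle (x : LauForm k a b n) : Prop where
  kills : x.Kills
  right : x.StdLE xdeg a
  left : x.StdLE (-xdeg) 0
  top : x.StdLE zdeg b
  bot : x.StdLE (-zdeg) 0

/-- The difference of the lifts at the two top corners. -/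
def topDiff : LauForm k a b n →ₗ[k] LauForm k a b (n + 1) :=
  lift (Fin.last a, Fin.last b) - lift (0, Fin.last b)

/-- The difference of the lifts at the two bottom corners. -/
def botDiff : LauForm k a b n →ₗ[k] LauForm k a b (n + 1) := lift (Fin.last a, 0) - lift (0, 0)

variable {x : LauForm k a b n}

theorem kills_lift_sub_lift (hx : x.Kills) (Q Q' : Grid a b) : (lift Q x - lift Q' x).Kills :=
  LauForm.kills_of_vecCons fun ψ => by
    rw [AlternatingMap.sub_apply, lift_vecCons_ev Q hx, lift_vecCons_ev Q' hx, sub_self]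

theorem LauForm.IsCocycle.edgePair (hx : x.IsCocycle) :
    EdgePair (botDiff x) (topDiff x) (lift (0, Fin.last b) x - lift (0, 0) x)
      (lift (Fin.last a, Fin.last b) x - lift (Fin.last a, 0) x) where
  sub_eq := by simp only [botDiff, topDiff, LinearMap.sub_apply]; abel
  kills₀ := kills_lift_sub_lift hx.kills _ _
  kills₁ := kills_lift_sub_lift hx.kills _ _
  killsD := kills_lift_sub_lift hx.kills _ _
  stdD₁ := by
    refine .sub (.mono ?_ (lift_stdLE _ hx.right)) (.mono ?_ (lift_stdLE _ hx.right)) <;>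
      simp [gridExp]
  stdD₀ := by
    refine .sub (.mono ?_ (lift_stdLE _ hx.left)) (.mono ?_ (lift_stdLE _ hx.left)) <;>
      simp [gridExp]
  std₀ := by
    refine .sub (.mono ?_ (lift_stdLE _ hx.bot)) (.mono ?_ (lift_stdLE _ hx.bot)) <;>
      simp [gridExp]
  std₁ := by
    refine .sub (.mono ?_ (lift_stdLE _ hx.top)) (.mono ?_ (lift_stdLE _ hx.top)) <;>
      simp [gridExp]

theorem bv_origin : bv k a b (0, 0) = ev := by simp [bv, ev]

theorem bv'_origin : bv' k a b (0, 0) = ev := by simp [bv', ev]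

theorem mixed_empty (u : Fin n → Grid a b) :
    mixed k a b (fun t => ((u t).1.val, (u t).2.val)) ∅ = fun t => bv k a b (u t) := by
  funext t
  simp [mixed, nb, bv]

theorem mixed_univ (u : Fin n → Grid a b) :
    mixed k a b (fun t => ((u t).1.val, (u t).2.val)) Finset.univ = fun t => bv' k a b (u t) := by
  funext t
  simp [mixed, nb', bv']

theorem exists_bot_part (hx : x.IsCocycle) (h : ∀ m, BotVanish (topDiff x) m) :
    ∃ ω' : LauForm k a b (n + 1), ω'.Kills ∧ ω'.StdLE (-xdeg) 0 ∧
      (ω' - botDiff x).StdLE xdeg 0 ∧ ω'.StdLE (-zdeg) 0 := by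
  refine LauForm.exists_nonneg_part (B := bv k a b) (w := fun _ => 0) bv_origin
    (stdv_mem_wspan_bv (fun P => by split_ifs <;> simp) (by simp)
      (fun P _ => by split_ifs <;> simp))
    (stdv_mem_wspan_bv (by simp) (by simp) (by simp))
    (stdv_mem_wspan_bv (by simp) (by simp) (by simp)) hx.edgePair.kills₀ (fun u => ?_)
    (fun u c σ hc hc' => ?_)
  · have := hx.edgePair.std₀.apply_mem (fun _ => 0) (fun j => bv k a b (u j)) ?_
    · simpa using this
    · intro j P
      unfold bv
      split_ifs
      · exact gv_mem_degLE (by intros; simp) P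
      · exact fv_mem_degLE (by intros; simp) P
  · rw [← mixed_empty, ← hx.edgePair.coeff_eq _ _ hc hc']
    exact h _ _ (fun t => by have := (u t).2.isLt; dsimp only; omega) rfl _ _ _ hc hc'

theorem exists_top_part (hx : x.IsCocycle) (h : ∀ m, BotVanish (topDiff x) m) :
    ∃ ω' : LauForm k a b (n + 1), ω'.Kills ∧ ω'.StdLE (-xdeg) 0 ∧
      (ω' - topDiff x).StdLE xdeg 0 ∧ ω'.StdLE zdeg 0 := by
  refine LauForm.exists_nonneg_part (B := bv' k a b)
    (w := fun P => if (P.2 : ℕ) = 0 then -b else 1) bv'_origin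
    (stdv_mem_wspan_bv' (fun P _ => by split_ifs <;> simp)
      (fun P _ => by split_ifs <;> simp) (by simp) (by simp))
    (stdv_mem_wspan_bv' (by simp) (by simp) (by simp) (by simp))
    (stdv_mem_wspan_bv' (by simp +contextual) (by simp +contextual) (by simp) (by simp))
    hx.edgePair.kills₁ (fun u => ?_) (fun u c σ hc hc' => ?_)
  · have := hx.edgePair.std₁.apply_mem
      (fun j => -(if ((u j).2 : ℕ) = 0 then -(b : ℤ) else 1)) (fun j => bv' k a b (u j)) ?_
    · rwa [Finset.sum_neg_distrib, ← sub_eq_add_neg] at this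
    · intro j P
      unfold bv'
      split_ifs
      · exact gv_mem_degLE (by intros; simp; omega) P
      · exact fv'_mem_degLE (by intros; simp; omega) P
  · rw [← mixed_univ]
    exact h _ _ (fun t => by have := (u t).2.isLt; dsimp only; omega) rfl _ _ _ hc hc'

/-- Pairs of lifts of a common form, both of horizontal degree zero, the first one having
nonnegative and the second one nonpositive vertical degree. -/
structure IsLiftPair (y₀ y₁ : LauForm k a b (n + 1)) : Prop where
  kills : (y₁ - y₀).Kills
  right₀ : y₀.StdLE xdeg 0
  left₀ : y₀.StdLE (-xdeg) 0
  right₁ : y₁.StdLE xdeg 0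
  left₁ : y₁.StdLE (-xdeg) 0
  bot₀ : y₀.StdLE (-zdeg) 0
  top₁ : y₁.StdLE zdeg 0

theorem exists_isLiftPair (hx : x.IsCocycle) (h : ∀ m, BotVanish (topDiff x) m) :
    ∃ y₀ y₁ : LauForm k a b (n + 1), IsLiftPair y₀ y₁ ∧ y₀.curryLeft ev = x := by
  obtain ⟨ω₀, k₀, l₀, r₀, z₀⟩ := exists_bot_part hx h
  obtain ⟨ω₁, k₁, l₁, r₁, z₁⟩ := exists_top_part hx h
  refine ⟨lift (0, 0) x + ω₀, lift (0, Fin.last b) x + ω₁, ⟨?_, ?_, ?_, ?_, ?_, ?_, ?_⟩, ?_⟩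
  · rw [add_sub_add_comm]
    intro v t ht
    rw [AlternatingMap.add_apply, kills_lift_sub_lift hx.kills _ _ v t ht,
      (k₁.sub k₀) v t ht, add_zero]
  · have : lift (0, 0) x + ω₀ = lift (Fin.last a, 0) x + (ω₀ - botDiff x) := by
      simp only [botDiff, LinearMap.sub_apply]; abel
    rw [this]
    exact .add (.mono (by simp [gridExp]) (lift_stdLE _ hx.right)) r₀
  · exact .add (.mono (by simp [gridExp]) (lift_stdLE _ hx.left)) l₀
  · have : lift (0, Fin.last b) x + ω₁ = lift (Fin.last a, Fin.last b) x + (ω₁ - topDiff x) := by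
      simp only [topDiff, LinearMap.sub_apply]; abel
    rw [this]
    exact .add (.mono (by simp [gridExp]) (lift_stdLE _ hx.right)) r₁
  · exact .add (.mono (by simp [gridExp]) (lift_stdLE _ hx.left)) l₁
  · exact .add (.mono (by simp [gridExp]) (lift_stdLE _ hx.bot)) z₀
  · exact .add (.mono (by simp [gridExp]) (lift_stdLE _ hx.top)) z₁
  · ext1 ψ
    rw [AlternatingMap.curryLeft_apply_apply, AlternatingMap.add_apply,
      lift_vecCons_ev _ hx.kills, k₀ _ 0 rfl, add_zero]

end Lifts

section Glue

variable {k : Type*} [Field k] {a b n : ℕ}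

theorem rb_mem_degLE_xdeg (P Q : Grid a b) : rb k a b P Q ∈ DegLE xdeg 0 :=
  fv_mem_degLE (by intros; simp) Q

theorem rb_mem_degLE_neg_xdeg (P Q : Grid a b) : rb k a b P Q ∈ DegLE (-xdeg) 0 :=
  fv_mem_degLE (by intros; simp) Q

theorem coeff_eq_zero_of_xdeg {f : Lau k} (h : f ∈ DegLE xdeg 0) (h' : f ∈ DegLE (-xdeg) 0)
    {d : ℤ × ℤ} (hd : d.1 ≠ 0) : f.coeff d = 0 := by
  rcases lt_or_gt_of_ne hd with h0 | h0
  · exact h' d (by simpa using h0)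
  · exact h d (by simpa using h0)

variable {θ : LauForm k a b (n + 1)}

theorem curryLeft_ev_eq_sum (θ : LauForm k a b (n + 1)) (ψ : Fin n → Vec k a b) :
    θ (Matrix.vecCons ev ψ) =
      ∑ i : Fin (a + 1), mon k ((i : ℤ), 0) * θ (Matrix.vecCons (rb k a b (i, 0)) ψ) := by
  let L : Vec k a b →ₗ[Lau k] Lau k :=
    { toFun v := θ (Matrix.vecCons v ψ)
      map_add' := θ.map_vecCons_add ψ
      map_smul' := θ.map_vecCons_smul ψ }
  change L ev = ∑ i : Fin (a + 1), mon k ((i : ℤ), 0) • L (fv i 0)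
  rw [ev_eq_sum_fv, map_sum]
  simp only [map_smul]

/-- A form of horizontal degree zero which kills `ev` vanishes on the bottom row. -/
theorem LauForm.Kills.apply_rb_eq_zero (hk : θ.Kills) (hr : θ.StdLE xdeg 0)
    (hl : θ.StdLE (-xdeg) 0) (u : Fin (n + 1) → Grid a b) {t : Fin (n + 1)}
    (ht : (u t).2 = 0) : θ (fun j => rb k a b (u j)) = 0 := by
  have h1 : ∀ u : Fin (n + 1) → Grid a b, θ (fun j => rb k a b (u j)) ∈ DegLE xdeg 0 := fun u => by
    simpa using hr.apply_mem (fun _ => 0) _ fun j P => rb_mem_degLE_xdeg (u j) P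
  have h2 : ∀ u : Fin (n + 1) → Grid a b, θ (fun j => rb k a b (u j)) ∈ DegLE (-xdeg) 0 :=
    fun u => by simpa using hl.apply_mem (fun _ => 0) _ fun j P => rb_mem_degLE_neg_xdeg (u j) P
  have hcons : ∀ (P : Grid a b) (v : Fin n → Grid a b),
      (Matrix.vecCons (rb k a b P) (fun j => rb k a b (v j)) : Fin (n + 1) → Vec k a b) =
        fun j => rb k a b (Matrix.vecCons P v j) := by
    intro P v
    funext j
    refine Fin.cases ?_ (fun j => ?_) j <;> simp
  have key : ∀ (i : Fin (a + 1)) (v : Fin n → Grid a b),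
      θ (Matrix.vecCons (rb k a b (i, 0)) (fun j => rb k a b (v j))) = 0 := by
    intro i v
    ext d
    by_cases hd : d.1 = 0
    swap
    · rw [hcons]
      exact coeff_eq_zero_of_xdeg (h1 _) (h2 _) hd
    have h0 := curryLeft_ev_eq_sum θ (fun j => rb k a b (v j))
    rw [hk _ 0 rfl] at h0
    have h3 := congrArg (fun f => f.coeff (((i : ℤ), 0) + d)) h0
    simp only [AddMonoidAlgebra.coeff_sum, Finsupp.finsetSum_apply, mon_mul_coeff] at h3
    rw [Finset.sum_eq_single i, add_sub_cancel_left] at h3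
    · exact h3.symm
    · intro i' _ hi'
      rw [hcons]
      refine coeff_eq_zero_of_xdeg (h1 _) (h2 _) ?_
      simp only [Prod.fst_sub, Prod.fst_add, hd, add_zero]
      intro h
      exact hi' (Fin.ext (by omega))
    · simp
  rw [← Fin.insertNth_self_removeNth t (fun j => rb k a b (u j)), AlternatingMap.map_insertNth,
    show u t = ((u t).1, 0) from Prod.ext rfl ht]
  have := key (u t).1 (t.removeNth u)
  rw [show (t.removeNth fun j => rb k a b (u j)) = fun j => rb k a b (t.removeNth u j) from rfl,
    this, smul_zero]

/-- The lattice points above the bottom row. -/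
def upper (a b : ℕ) : Finset (Grid a b) := Finset.univ.filter fun P => P.2 ≠ 0

theorem card_upper : (upper a b).card = (a + 1) * b := by
  have : upper a b = Finset.univ ×ˢ Finset.univ.erase 0 := by
    ext P
    simp [upper]
  rw [this, Finset.card_product]
  simp

/-- The elements of a finite set of lattice points of cardinality `m`, in some order. -/
def enum {m : ℕ} (S : (upper a b).powersetCard m) (j : Fin m) : Grid a b :=
  ((S.1.equivFinOfCardEq (Finset.mem_powersetCard.mp S.2).2).symm j).1

theorem exists_enum_eq {m : ℕ} (S : (upper a b).powersetCard m) {P : Grid a b} (h : P ∈ S.1) :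
    ∃ j, enum S j = P :=
  ⟨S.1.equivFinOfCardEq (Finset.mem_powersetCard.mp S.2).2 ⟨P, h⟩, by simp [enum]⟩

/-- The coefficient of the value on a tuple, as a linear function of the form. -/
def coeffAt (v : Fin n → Vec k a b) (d : ℤ × ℤ) : LauForm k a b n →ₗ[k] k where
  toFun ω := (ω v).coeff d
  map_add' _ _ := rfl
  map_smul' _ _ := rfl

variable (k a b n) in
/-- The coefficients obstructing the vertical splitting of a form of horizontal degree zero. -/
def vertCoeffs :
    LauForm k a b (n + 1) →ₗ[k] ((upper a b).powersetCard (n + 1) × Fin n → k) :=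
  LinearMap.pi fun q => coeffAt (fun j => rb k a b (enum q.1 j)) (0, -((q.2 : ℤ) + 1))

theorem coeff_eq_zero_of_vertCoeffs (hk : θ.Kills) (hr : θ.StdLE xdeg 0)
    (hl : θ.StdLE (-xdeg) 0) (h : vertCoeffs k a b n θ = 0) (u : Fin (n + 1) → Grid a b)
    {d : ℤ × ℤ} (hd : -(n + 1 : ℤ) < d.2) (hd' : d.2 < 0) :
    (θ fun j => rb k a b (u j)).coeff d = 0 := by
  classical
  by_cases hx : d.1 = 0
  swap
  · refine coeff_eq_zero_of_xdeg ?_ ?_ hx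
    · simpa using hr.apply_mem (fun _ => 0) _ fun j P => rb_mem_degLE_xdeg (u j) P
    · simpa using hl.apply_mem (fun _ => 0) _ fun j P => rb_mem_degLE_neg_xdeg (u j) P
  by_cases hu : Function.Injective u
  swap
  · rw [AlternatingMap.map_eq_zero_of_not_injective]
    · simp
    · intro h'
      exact hu fun i j hij => h' (by simp [hij])
  by_cases hb : ∃ t, (u t).2 = 0
  · obtain ⟨t, ht⟩ := hb
    rw [hk.apply_rb_eq_zero hr hl u ht]
    simp
  push Not at hb
  let S : (upper a b).powersetCard (n + 1) := ⟨Finset.univ.image u, by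
    rw [Finset.mem_powersetCard, Finset.card_image_of_injective _ hu, Finset.card_fin]
    refine ⟨fun P hP => ?_, rfl⟩
    obtain ⟨t, -, rfl⟩ := Finset.mem_image.mp hP
    simpa [upper] using hb t⟩
  refine θ.coeff_eq_zero_of_range_eq (rb k a b) (u₀ := enum S) hu
    (fun j => exists_enum_eq S (Finset.mem_image_of_mem u (Finset.mem_univ j))) ?_
  have hs : (-d.2 - 1).toNat < n := by omega
  have := congrFun h (S, ⟨_, hs⟩)
  have e : d = (0, -((((-d.2 - 1).toNat : ℕ) : ℤ) + 1)) := by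
    ext
    · exact hx
    · dsimp only; omega
  rw [e]
  exact this

/-- If the obstructing coefficients vanish, a pair of lifts can be glued to a constant lift. -/
theorem IsLiftPair.exists_constant {y₀ y₁ : LauForm k a b (n + 1)} (h : IsLiftPair y₀ y₁)
    (h0 : vertCoeffs k a b n (y₁ - y₀) = 0) :
    ∃ y : LauForm k a b (n + 1), y.StdLE xdeg 0 ∧ y.StdLE (-xdeg) 0 ∧ y.StdLE zdeg 0 ∧
      y.StdLE (-zdeg) 0 ∧ y.curryLeft ev = y₀.curryLeft ev := by
  have hr := h.right₁.sub h.right₀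
  have hl := h.left₁.sub h.left₀
  have hspan : ∀ {ℓ : ℤ × ℤ →+ ℤ}, ℓ (0, 1) ≤ 0 → ∀ P : Grid a b,
      (stdv P : Vec k a b) ∈ WSpan (rb k a b) ℓ fun _ => 0 := fun hℓ =>
    stdv_mem_wspan_rb (fun _ => le_rfl) (fun _ => hℓ)
  obtain ⟨β, hβ⟩ := exists_basis (hspan (ℓ := xdeg) (by simp))
  obtain ⟨θ', hθ'⟩ := LauForm.exists_compose β (trunc fun d => 0 ≤ d.2) (y₁ - y₀)
  simp only [hβ] at hθ'
  have hxr : θ'.StdLE xdeg 0 := by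
    refine LauForm.stdLE_of_wspan (hspan (by simp)) fun u => ?_
    rw [hθ']
    refine trunc_mem_degLE _ ?_
    simpa using hr.apply_mem (fun _ => 0) _ fun j P => rb_mem_degLE_xdeg (u j) P
  have hxl : θ'.StdLE (-xdeg) 0 := by
    refine LauForm.stdLE_of_wspan (hspan (by simp)) fun u => ?_
    rw [hθ']
    refine trunc_mem_degLE _ ?_
    simpa using hl.apply_mem (fun _ => 0) _ fun j P => rb_mem_degLE_neg_xdeg (u j) P
  have hzl : θ'.StdLE (-zdeg) 0 := by
    refine LauForm.stdLE_of_wspan (hspan (by simp)) fun u => ?_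
    rw [hθ']
    intro d hd
    rw [trunc_coeff, if_neg]
    simp at hd
    omega
  have hzr : (θ' - (y₁ - y₀)).StdLE zdeg 0 := by
    refine LauForm.stdLE_of_wspan (w := fun _ => 1)
      (stdv_mem_wspan_rb (by simp) (by simp)) fun u => ?_
    rw [AlternatingMap.sub_apply, hθ']
    intro d hd
    rw [AddMonoidAlgebra.coeff_sub, Finsupp.sub_apply, trunc_coeff]
    split_ifs with hd0
    · exact sub_self _
    · simp at hd
      rw [coeff_eq_zero_of_vertCoeffs h.kills hr hl h0 u (by linarith) (by omega), sub_zero]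
  have hk : θ'.curryLeft ev = 0 := by
    refine β.ext_alternating fun v _ => ?_
    rw [AlternatingMap.curryLeft_apply_apply, AlternatingMap.zero_apply, curryLeft_ev_eq_sum]
    refine Finset.sum_eq_zero fun i _ => ?_
    have e : (Matrix.vecCons (rb k a b (i, 0)) (fun j => β (v j)) : Fin (n + 1) → Vec k a b) =
        fun j => rb k a b (Matrix.vecCons (i, 0) v j) := by
      funext j
      refine Fin.cases ?_ (fun j => ?_) j <;> simp [hβ]
    rw [e, hθ', h.kills.apply_rb_eq_zero hr hl _ (t := 0) rfl, map_zero, mul_zero]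
  refine ⟨y₀ + θ', h.right₀.add hxr, h.left₀.add hxl, ?_, h.bot₀.add hzl, ?_⟩
  · have : y₀ + θ' = y₁ + (θ' - (y₁ - y₀)) := by abel
    rw [this]
    exact h.top₁.add hzr
  · rw [AlternatingMap.curryLeft_add, LinearMap.add_apply, hk, add_zero]

end Glue

section Dehomogenize

variable {k : Type*} [Field k] {a b n : ℕ}

variable (k) in
/-- Dehomogenization `y = w = 1`. -/
def dehom : MvPolynomial (Fin 4) k →ₐ[k] Lau k :=
  MvPolynomial.aeval ![mon k (1, 0), 1, mon k (0, 1), 1]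

theorem mon_pow (d : ℤ × ℤ) (r : ℕ) : mon k d ^ r = mon k (r • d) := by
  simp [mon, AddMonoidAlgebra.single_pow]

theorem dehom_monomial (m : Fin 4 →₀ ℕ) (c : k) :
    dehom k (monomial m c) = c • mon k ((m 0 : ℤ), (m 2 : ℤ)) := by
  rw [dehom, MvPolynomial.aeval_monomial, Algebra.smul_def]
  congr 1
  rw [Finsupp.prod_fintype _ _ (by simp), Fin.prod_univ_four]
  simp only [Matrix.cons_val_zero, Matrix.cons_val_one, Matrix.cons_val, one_pow, mul_one,
    mon_pow, mon_mul_mon]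
  congr 1
  ext <;> simp

theorem dehom_coeff_eq_sum (f : MvPolynomial (Fin 4) k) (d : ℤ × ℤ) :
    (dehom k f).coeff d =
      ∑ m ∈ f.support, if (((m 0 : ℤ), (m 2 : ℤ)) : ℤ × ℤ) = d then f.coeff m else 0 := by
  conv_lhs => rw [f.as_sum, map_sum]
  simp only [dehom_monomial, AddMonoidAlgebra.coeff_sum, Finsupp.finsetSum_apply]
  refine Finset.sum_congr rfl fun m _ => ?_
  rw [AddMonoidAlgebra.coeff_smul, Finsupp.smul_apply, mon_coeff]
  simp

theorem exists_of_dehom_coeff_ne_zero {f : MvPolynomial (Fin 4) k} {d : ℤ × ℤ}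
    (h : (dehom k f).coeff d ≠ 0) :
    ∃ m ∈ f.support, d = ((m 0 : ℤ), (m 2 : ℤ)) := by
  rw [dehom_coeff_eq_sum] at h
  obtain ⟨m, hm, h⟩ := Finset.exists_ne_zero_of_sum_ne_zero h
  exact ⟨m, hm, by by_contra h'; exact h (if_neg (Ne.symm h'))⟩

theorem dehom_coeff {d e : ℕ} {f : MvPolynomial (Fin 4) k} (hf : f ∈ Bihom k d e)
    {m : Fin 4 →₀ ℕ} (h1 : m 0 + m 1 = d) (h2 : m 2 + m 3 = e) :
    (dehom k f).coeff ((m 0 : ℤ), (m 2 : ℤ)) = f.coeff m := by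
  rw [dehom_coeff_eq_sum, Finset.sum_eq_single m]
  · simp
  · intro m' hm' hne
    rw [if_neg]
    intro h
    obtain ⟨h3, h4⟩ := hf m' hm'
    simp only [Prod.mk.injEq, Nat.cast_inj] at h
    refine hne (Finsupp.ext fun i => ?_)
    fin_cases i
    · exact h.1
    · show m' 1 = m 1
      omega
    · exact h.2
    · show m' 3 = m 3
      omega
  · intro h
    simpa using h

theorem eq_zero_of_dehom {d e : ℕ} {f : MvPolynomial (Fin 4) k} (hf : f ∈ Bihom k d e)
    (h : dehom k f = 0) : f = 0 := by
  by_contra hne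
  obtain ⟨m, hm⟩ := MvPolynomial.support_nonempty.mpr hne
  obtain ⟨h1, h2⟩ := hf m hm
  rw [mem_support_iff, ← dehom_coeff hf h1 h2, h] at hm
  simp at hm

theorem dehom_mem_degLE {d e : ℕ} {f : MvPolynomial (Fin 4) k} (hf : f ∈ Bihom k d e)
    {ℓ : ℤ × ℤ →+ ℤ} {m : ℤ} (h : ∀ i j : ℕ, i ≤ d → j ≤ e → ℓ ((i : ℤ), (j : ℤ)) ≤ m) :
    dehom k f ∈ DegLE ℓ m := by
  intro c hc
  by_contra hne
  obtain ⟨μ, hμ, rfl⟩ := exists_of_dehom_coeff_ne_zero hne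
  obtain ⟨h1, h2⟩ := hf μ hμ
  have := h (μ 0) (μ 2) (by omega) (by omega)
  omega

/-- The coordinates of an element of `R_1` with respect to the monomials. -/
def gridCoords : RS k a b 1 →ₗ[k] (Grid a b → k) where
  toFun v P := (dehom k v.1).coeff (gridExp P)
  map_add' v w := by ext P; simp
  map_smul' c v := by ext P; simp

theorem gridExp_injective : Function.Injective (gridExp : Grid a b → ℤ × ℤ) := by
  intro P Q h
  simp only [gridExp, Prod.mk.injEq, Nat.cast_inj] at h
  exact Prod.ext (Fin.ext h.1) (Fin.ext h.2)

theorem gridCoords_bijective :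
    Function.Bijective (gridCoords : RS k a b 1 →ₗ[k] (Grid a b → k)) := by
  constructor
  · rw [← LinearMap.ker_eq_bot, LinearMap.ker_eq_bot']
    intro v hv
    refine Subtype.ext (eq_zero_of_dehom v.2 ?_)
    ext d
    by_contra hne
    obtain ⟨m, hm, rfl⟩ := exists_of_dehom_coeff_ne_zero hne
    obtain ⟨h1, h2⟩ := v.2 m hm
    exact hne (congrFun hv (⟨m 0, by omega⟩, ⟨m 2, by omega⟩))
  · intro c
    let μ (P : Grid a b) : Fin 4 →₀ ℕ :=
      Finsupp.equivFunOnFinite.symm ![P.1, a - P.1, P.2, b - P.2]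
    have hμ : ∀ P, monomial (μ P) (c P) ∈ RS k a b 1 := by
      intro P m hm
      obtain rfl := Finset.mem_singleton.mp (support_monomial_subset hm)
      have h1 := P.1.isLt
      have h2 := P.2.isLt
      simp [μ]
      omega
    refine ⟨⟨∑ P, monomial (μ P) (c P), Submodule.sum_mem _ fun P _ => hμ P⟩, ?_⟩
    ext Q
    have e : ∀ P, (((μ P 0 : ℕ) : ℤ), ((μ P 2 : ℕ) : ℤ)) = gridExp P := fun P => by
      simp [μ, gridExp]
    simp only [gridCoords, LinearMap.coe_mk, AddHom.coe_mk, map_sum, dehom_monomial, e,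
      AddMonoidAlgebra.coeff_sum, Finsupp.finsetSum_apply, AddMonoidAlgebra.coeff_smul,
      Finsupp.smul_apply, mon_coeff, gridExp_injective.eq_iff]
    simp

variable (k a b) in
/-- The monomial basis of `R_1`. -/
def gridBasis : Module.Basis (Grid a b) k (RS k a b 1) :=
  .ofEquivFun (LinearEquiv.ofBijective gridCoords gridCoords_bijective)

theorem gridCoords_gridBasis (P Q : Grid a b) :
    gridCoords (gridBasis k a b P) Q = if Q = P then 1 else 0 := by
  classical
  have : gridCoords (gridBasis k a b P) = Pi.single P 1 := by
    simp only [gridBasis, Module.Basis.coe_ofEquivFun]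
    exact (LinearEquiv.ofBijective gridCoords gridCoords_bijective).apply_symm_apply _
  rw [this, Pi.single_apply]

/-- The linear functional on `Vec` with the coordinates of `v`. -/
def functional : RS k a b 1 →ₗ[k] (Vec k a b →ₗ[Lau k] Lau k) where
  toFun v := ∑ P, gridCoords v P • LinearMap.proj P
  map_add' v w := by simp [add_smul, Finset.sum_add_distrib]
  map_smul' c v := by simp [mul_smul, Finset.smul_sum]

theorem functional_apply (v : RS k a b 1) (ψ : Vec k a b) :
    functional v ψ = ∑ P, gridCoords v P • ψ P := by
  simp [functional]

theorem functional_ev (v : RS k a b 1) : functional v ev = dehom k v.1 := by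
  rw [functional_apply]
  ext d
  simp only [ev_apply, AddMonoidAlgebra.coeff_sum, Finsupp.finsetSum_apply,
    AddMonoidAlgebra.coeff_smul, Finsupp.smul_apply, mon_coeff, smul_eq_mul, mul_ite, mul_one,
    mul_zero]
  by_cases h : (dehom k v.1).coeff d = 0
  · rw [h]
    refine Finset.sum_eq_zero fun P _ => ?_
    split_ifs with hP
    · rw [← h, ← hP]; rfl
    · rfl
  · obtain ⟨m, hm, rfl⟩ := exists_of_dehom_coeff_ne_zero h
    obtain ⟨h1, h2⟩ := v.2 m hm
    let Q : Grid a b := (⟨m 0, by omega⟩, ⟨m 2, by omega⟩)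
    have hQ : ((m 0 : ℤ), (m 2 : ℤ)) = gridExp Q := rfl
    simp only [hQ, gridExp_injective.eq_iff, Finset.sum_ite_eq', Finset.mem_univ, if_true]
    rfl

theorem functional_stdv (v : RS k a b 1) (P : Grid a b) :
    functional v (stdv P) = gridCoords v P • 1 := by
  rw [functional_apply, Finset.sum_eq_single P]
  · simp [stdv_apply]
  · intro Q _ hQ
    simp [stdv_apply, hQ]
  · simp

end Dehomogenize

section WedgeBasis

variable {a b n : ℕ}

/-- A linear order on the lattice points. -/
abbrev gridOrder (a b : ℕ) : LinearOrder (Grid a b) :=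
  LinearOrder.lift' _ (Fintype.equivFin (Grid a b)).injective

/-- The increasing tuple of the elements of a set of lattice points. -/
def tuple (S : Set.powersetCard (Grid a b) n) : Fin n → Grid a b :=
  letI := gridOrder a b
  Set.powersetCard.ofFinEmbEquiv.symm S

theorem tuple_injective (S : Set.powersetCard (Grid a b) n) : Function.Injective (tuple S) :=
  letI := gridOrder a b
  (Set.powersetCard.ofFinEmbEquiv.symm S).injective

theorem exists_tuple_eq_iff (S : Set.powersetCard (Grid a b) n) (P : Grid a b) :
    (∃ j, tuple S j = P) ↔ P ∈ S :=
  letI := gridOrder a b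
  Set.powersetCard.mem_range_ofFinEmbEquiv_symm_iff_mem S P

/-- The basis of the exterior power indexed by sets of lattice points. -/
def wedgeBasis {R M : Type*} [CommRing R] [AddCommGroup M] [Module R M]
    (β : Module.Basis (Grid a b) R M) (n : ℕ) :
    Module.Basis (Set.powersetCard (Grid a b) n) R (⋀[R]^n M) :=
  letI := gridOrder a b
  β.exteriorPower n

theorem wedgeBasis_apply {R M : Type*} [CommRing R] [AddCommGroup M] [Module R M]
    (β : Module.Basis (Grid a b) R M) (S : Set.powersetCard (Grid a b) n) :
    wedgeBasis β n S = exteriorPower.ιMulti R n (fun j => β (tuple S j)) :=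
  letI := gridOrder a b
  exteriorPower.basis_apply R n β S

theorem exists_tuple_ne {S T : Set.powersetCard (Grid a b) n} (h : S ≠ T) :
    ∃ i, ∀ j, tuple S j ≠ tuple T i := by
  by_contra! hc
  refine h (Subtype.ext (Finset.eq_of_subset_of_card_le (s := T.1) (t := S.1) ?_ ?_).symm)
  · intro P hP
    obtain ⟨i, rfl⟩ := (exists_tuple_eq_iff T P).mpr hP
    exact (exists_tuple_eq_iff S _).mp (hc i)
  · rw [S.2, T.2]

end WedgeBasis

section Comparison

variable {k : Type*} [Field k] {a b n q : ℕ}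

theorem LauForm.sum_apply {ι : Type*} (s : Finset ι) (F : ι → LauForm k a b n)
    (v : Fin n → Vec k a b) : (∑ i ∈ s, F i) v = ∑ i ∈ s, F i v :=
  map_sum (⟨⟨fun ω => ω v, fun _ _ => rfl⟩, fun _ _ => rfl⟩ : LauForm k a b n →ₗ[k] Lau k) F s

theorem LauForm.ext_tuple {ω ω' : LauForm k a b n}
    (h : ∀ S : Set.powersetCard (Grid a b) n,
      ω (fun j => stdv (tuple S j)) = ω' (fun j => stdv (tuple S j))) : ω = ω' := by
  classical
  apply (exteriorPower.alternatingMapLinearEquiv (R := Lau k) (M := Vec k a b)).injective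
  refine (wedgeBasis (Pi.basisFun (Lau k) (Grid a b)) n).ext fun S => ?_
  rw [wedgeBasis_apply, exteriorPower.alternatingMapLinearEquiv_apply_ιMulti,
    exteriorPower.alternatingMapLinearEquiv_apply_ιMulti]
  convert h S <;> ext1 <;> simp [stdv_apply, Pi.single_apply]

theorem of_functional_update (v : Fin n → RS k a b 1) (j : Fin n) (z : RS k a b 1)
    (ψ : Fin n → Vec k a b) :
    (Matrix.of fun i j' => functional (Function.update v j z j') (ψ i)) =
      (Matrix.of fun i j' => functional (v j') (ψ i)).updateCol j
        fun i => functional z (ψ i) := by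
  ext1 i j'
  by_cases h : j' = j
  · subst h; simp
  · simp [h]

/-- The form `ψ ↦ det (v_j (ψ_i))`. -/
def detForm : RS k a b 1 [⋀^Fin n]→ₗ[k] LauForm k a b n where
  toFun v := Matrix.detRowAlternating.compLinearMap (LinearMap.pi fun j => functional (v j))
  map_update_add' := by
    intro inst v j x y
    obtain rfl : inst = instDecidableEqFin n := Subsingleton.elim _ _
    ext1 ψ
    change Matrix.det (Matrix.of fun i j' => functional (Function.update v j (x + y) j') (ψ i)) =
      Matrix.det (Matrix.of fun i j' => functional (Function.update v j x j') (ψ i)) +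
      Matrix.det (Matrix.of fun i j' => functional (Function.update v j y j') (ψ i))
    rw [of_functional_update, of_functional_update, of_functional_update,
      ← Matrix.det_updateCol_add]
    congr
    ext1 i
    simp
  map_update_smul' := by
    intro inst v j c x
    obtain rfl : inst = instDecidableEqFin n := Subsingleton.elim _ _
    ext1 ψ
    change Matrix.det (Matrix.of fun i j' => functional (Function.update v j (c • x) j') (ψ i)) =
      c • Matrix.det (Matrix.of fun i j' => functional (Function.update v j x j') (ψ i))
    rw [of_functional_update, of_functional_update, Algebra.smul_def,
      ← Matrix.det_updateCol_smul]
    congr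
    ext1 i
    simp only [map_smul, LinearMap.smul_apply, Pi.smul_apply, smul_eq_mul, Algebra.smul_def]
  map_eq_zero_of_eq' v i j h hij := by
    ext1 ψ
    refine Matrix.det_zero_of_column_eq hij fun l => ?_
    simp [h]

theorem detForm_apply (v : Fin n → RS k a b 1) (ψ : Fin n → Vec k a b) :
    detForm v ψ = (Matrix.of fun i j => functional (v j) (ψ i)).det := rfl

variable (k a b n q) in
/-- The comparison map from `Λ^n V ⊗ R_q` to alternating forms. -/
def toForm : (⋀[k]^n (RS k a b 1)) ⊗[k] (RS k a b q) →ₗ[k] LauForm k a b n :=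
  TensorProduct.lift (LinearMap.mk₂ k
    (fun ζ f => dehom k f.1 • exteriorPower.alternatingMapLinearEquiv detForm ζ)
    (fun ζ ζ' f => by rw [map_add, smul_add])
    (fun c ζ f => by rw [map_smul, smul_comm])
    (fun ζ f g => by rw [Submodule.coe_add, map_add, add_smul])
    (fun c ζ f => by
      ext1 ψ
      simp only [Submodule.coe_smul, map_smul, AlternatingMap.smul_apply, smul_assoc]))

theorem toForm_tmul (ζ : ⋀[k]^n (RS k a b 1)) (f : RS k a b q) :
    toForm k a b n q (ζ ⊗ₜ f) =
      dehom k f.1 • exteriorPower.alternatingMapLinearEquiv detForm ζ := rfl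

theorem toForm_wedge (v : Fin n → RS k a b 1) (f : RS k a b q) :
    toForm k a b n q (wedge k n v ⊗ₜ f) = dehom k f.1 • detForm v := by
  rw [toForm_tmul]
  congr 1
  exact exteriorPower.alternatingMapLinearEquiv_apply_ιMulti detForm v

theorem tensor_induction {p : (⋀[k]^n (RS k a b 1)) ⊗[k] (RS k a b q) → Prop}
    (h0 : p 0) (hw : ∀ v f, p (wedge k n v ⊗ₜ f)) (hadd : ∀ z z', p z → p z' → p (z + z'))
    (z : (⋀[k]^n (RS k a b 1)) ⊗[k] (RS k a b q)) : p z := by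
  induction z using TensorProduct.induction_on with
  | zero => exact h0
  | add z z' h h' => exact hadd z z' h h'
  | tmul ζ f =>
    have hζ : ζ ∈ Submodule.span k (Set.range (exteriorPower.ιMulti k n (M := RS k a b 1))) := by
      rw [exteriorPower.ιMulti_span]; trivial
    induction hζ using Submodule.span_induction generalizing f with
    | mem ζ h => obtain ⟨v, rfl⟩ := h; exact hw v f
    | zero => rw [TensorProduct.zero_tmul]; exact h0
    | add ζ ζ' _ _ h h' => rw [TensorProduct.add_tmul]; exact hadd _ _ (h f) (h' f)
    | smul c ζ _ h => rw [TensorProduct.smul_tmul]; exact h (c • f)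

theorem toForm_koszul {δ : KoszulMaps k a b} (hδ : IsKoszul k a b δ)
    (z : (⋀[k]^(n + 1) (RS k a b 1)) ⊗[k] (RS k a b q)) :
    toForm k a b n (q + 1) (δ n q z) = (toForm k a b (n + 1) q z).curryLeft ev := by
  induction z using tensor_induction with
  | h0 => simp
  | hadd z z' h h' => simp only [map_add, h, h', AlternatingMap.curryLeft_add,
      LinearMap.add_apply]
  | hw v f =>
    rw [hδ, map_sum]
    simp only [map_smul, toForm_wedge]
    ext1 ψ
    rw [AlternatingMap.curryLeft_apply_apply, AlternatingMap.smul_apply, detForm_apply,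
      Matrix.det_succ_row_zero, Finset.smul_sum]
    rw [LauForm.sum_apply]
    refine Finset.sum_congr rfl fun i _ => ?_
    have h1 : functional (v i) ((Matrix.vecCons ev ψ : Fin (n + 1) → Vec k a b) 0) =
        dehom k (v i).1 := functional_ev (v i)
    have h2 : ((Matrix.of fun i j => functional (v j)
        ((Matrix.vecCons ev ψ : Fin (n + 1) → Vec k a b) i)).submatrix Fin.succ i.succAbove).det =
        detForm (fun j => v (i.succAbove j)) ψ := rfl
    rw [Matrix.of_apply, h1, h2]
    simp only [AlternatingMap.smul_apply, segMul, map_mul, smul_eq_mul]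
    rw [Algebra.smul_def, map_pow, map_neg, map_one]
    ring

theorem toForm_stdLE {ℓ : ℤ × ℤ →+ ℤ} {m : ℤ}
    (h : ∀ i j : ℕ, i ≤ q * a → j ≤ q * b → ℓ ((i : ℤ), (j : ℤ)) ≤ m)
    (z : (⋀[k]^n (RS k a b 1)) ⊗[k] (RS k a b q)) : (toForm k a b n q z).StdLE ℓ m := by
  induction z using tensor_induction with
  | h0 => intro u; simp
  | hadd z z' h h' => rw [map_add]; exact h.add h'
  | hw v f =>
    intro u
    rw [toForm_wedge, AlternatingMap.smul_apply, smul_eq_mul, detForm_apply]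
    have e : (Matrix.of fun i j => functional (v j) (stdv (u i))) =
        (Matrix.of fun i j => gridCoords (v j) (u i)).map (algebraMap k (Lau k)) := by
      ext1 i j
      simp only [Matrix.of_apply, Matrix.map_apply, functional_stdv,
        Algebra.algebraMap_eq_smul_one]
    have e' := RingHom.map_det (algebraMap k (Lau k))
      (Matrix.of fun i j => gridCoords (v j) (u i))
    rw [RingHom.mapMatrix_apply, ← e] at e'
    rw [← e', mul_comm, ← Algebra.smul_def]
    exact Submodule.smul_mem _ _ (dehom_mem_degLE f.2 h)

theorem detForm_gridBasis (S T : Set.powersetCard (Grid a b) n) :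
    detForm (fun j => gridBasis k a b (tuple S j)) (fun j => stdv (tuple T j)) =
      if S = T then 1 else 0 := by
  classical
  rw [detForm_apply]
  simp only [functional_stdv, gridCoords_gridBasis]
  split_ifs with h
  · subst h
    refine Eq.trans (congrArg Matrix.det ?_) Matrix.det_one
    ext1 i j
    simp [Matrix.one_apply, (tuple_injective S).eq_iff]
  · obtain ⟨i, hi⟩ := exists_tuple_ne h
    refine Matrix.det_eq_zero_of_row_eq_zero i fun j => ?_
    simp [(hi j).symm]

theorem toForm_sum_tuple (c : Set.powersetCard (Grid a b) n →₀ RS k a b q)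
    (T : Set.powersetCard (Grid a b) n) :
    toForm k a b n q (c.sum fun S f => wedgeBasis (gridBasis k a b) n S ⊗ₜ f)
      (fun j => stdv (tuple T j)) = dehom k (c T).1 := by
  rw [Finsupp.sum, map_sum, LauForm.sum_apply]
  have h1 : ∀ S, toForm k a b n q (wedgeBasis (gridBasis k a b) n S ⊗ₜ c S)
      (fun j => stdv (tuple T j)) = if S = T then dehom k (c S).1 else 0 := fun S => by
    rw [wedgeBasis_apply, toForm_tmul, exteriorPower.alternatingMapLinearEquiv_apply_ιMulti,
      AlternatingMap.smul_apply, detForm_gridBasis, smul_eq_mul, mul_ite, mul_one, mul_zero]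
  simp only [h1, Finset.sum_ite_eq']
  split_ifs with h
  · rfl
  · rw [Finsupp.notMem_support_iff.mp h]
    simp

theorem toForm_injective : Function.Injective (toForm k a b n q) := by
  rw [← LinearMap.ker_eq_bot, LinearMap.ker_eq_bot']
  intro z hz
  obtain ⟨c, rfl⟩ := TensorProduct.eq_repr_basis_left (wedgeBasis (gridBasis k a b) n) z
  have : c = 0 := by
    ext1 T
    have h := toForm_sum_tuple c T
    rw [hz] at h
    exact Subtype.ext (eq_zero_of_dehom (c T).2 h.symm)
  rw [this, Finsupp.sum_zero_index]

/-- Every form with constant values on the standard basis comes from `Λ^n V ⊗ R_0`. -/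
theorem exists_toForm_eq {y : LauForm k a b n} (h1 : y.StdLE xdeg 0) (h2 : y.StdLE (-xdeg) 0)
    (h3 : y.StdLE zdeg 0) (h4 : y.StdLE (-zdeg) 0) : ∃ z, toForm k a b n 0 z = y := by
  classical
  have hC : ∀ c : k, (C c : MvPolynomial (Fin 4) k) ∈ RS k a b 0 := by
    intro c m hm
    obtain rfl := Finset.mem_singleton.mp (support_monomial_subset hm)
    simp
  let c : Set.powersetCard (Grid a b) n →₀ RS k a b 0 := Finsupp.equivFunOnFinite.symm fun S =>
    ⟨C ((y fun j => stdv (tuple S j)).coeff 0), hC _⟩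
  refine ⟨c.sum fun S f => wedgeBasis (gridBasis k a b) n S ⊗ₜ f, ?_⟩
  refine LauForm.ext_tuple fun S => ?_
  rw [toForm_sum_tuple]
  have e : dehom k (c S).1 = ((y fun j => stdv (tuple S j)).coeff 0) • mon k 0 := by
    exact dehom_monomial 0 _
  rw [e]
  ext d
  rw [AddMonoidAlgebra.coeff_smul, Finsupp.smul_apply, mon_coeff]
  split_ifs with hd
  · rw [← hd, smul_eq_mul, mul_one]
  · rw [smul_zero, eq_comm]
    by_cases hx : d.1 = 0
    · rcases lt_trichotomy d.2 0 with hz | hz | hz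
      · exact h4 _ d (by simpa using hz)
      · exact absurd (Prod.ext hx.symm hz.symm) hd
      · exact h3 _ d (by simpa using hz)
    · exact coeff_eq_zero_of_xdeg (h1 _) (h2 _) hx

theorem isCocycle_toForm {δ : KoszulMaps k a b} (hδ : IsKoszul k a b δ)
    {z : (⋀[k]^(n + 1) (RS k a b 1)) ⊗[k] (RS k a b 1)} (hz : δ n 1 z = 0) :
    (toForm k a b (n + 1) 1 z).IsCocycle where
  kills := LauForm.kills_of_vecCons fun ψ => by
    rw [← AlternatingMap.curryLeft_apply_apply, ← toForm_koszul hδ, hz, map_zero,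
      AlternatingMap.zero_apply]
  right := toForm_stdLE (by intros; simp; omega) z
  left := toForm_stdLE (by intros; simp) z
  top := toForm_stdLE (by intros; simp; omega) z
  bot := toForm_stdLE (by intros; simp) z

end Comparison

section LinearAlgebra

variable {k Z X L W₁ W₂ : Type*} [Field k] [AddCommGroup Z] [Module k Z] [AddCommGroup X]
  [Module k X] [AddCommGroup L] [Module k L] [AddCommGroup W₁] [Module k W₁]
  [Module.Finite k W₁] [AddCommGroup W₂] [Module k W₂] [Module.Finite k W₂]

/-- A quotient `Z ⧸ N` is bounded by two successive obstructions: `Θ`, which decides whether an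
element of `Z` lifts along `π`, and `ν`, which decides whether a lift witnesses membership
in `N`. -/
theorem finrank_quotient_le_of_obstructions (N : Submodule k Z) (ι : Z →ₗ[k] X) (Θ : Z →ₗ[k] W₁)
    (π : L →ₗ[k] X) (ν : L →ₗ[k] W₂) (hΘ : ∀ z, Θ z = 0 → ∃ l, π l = ι z)
    (hν : ∀ z l, π l = ι z → ν l = 0 → z ∈ N) :
    Module.finrank k (Z ⧸ N) ≤ Module.finrank k W₁ + Module.finrank k W₂ := by
  obtain ⟨σ, hσ⟩ := π.rangeRestrict.exists_rightInverse_of_surjective π.range_rangeRestrict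
  obtain ⟨η, hη⟩ := LinearMap.exists_extend (p := LinearMap.ker Θ)
    (ν ∘ₗ σ ∘ₗ (ι.domRestrict (LinearMap.ker Θ)).codRestrict (LinearMap.range π)
      fun z => hΘ z z.2)
  have hker : LinearMap.ker (Θ.prod η) ≤ N := fun z hz => by
    obtain ⟨h1, h2⟩ := Prod.ext_iff.mp (LinearMap.mem_ker.mp hz)
    have h3 := LinearMap.congr_fun hη ⟨z, h1⟩
    refine hν z _ ?_ (h3.symm.trans h2)
    exact congrArg Subtype.val (LinearMap.congr_fun hσ _)
  calc Module.finrank k (Z ⧸ N)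
      ≤ Module.finrank k (LinearMap.range (Θ.prod η)) := by
        refine LinearMap.finrank_le_finrank_of_surjective
          (f := Submodule.mapQ _ N LinearMap.id hker ∘ₗ
            (Θ.prod η).quotKerEquivRange.symm.toLinearMap) ?_
        intro w
        obtain ⟨z, rfl⟩ := N.mkQ_surjective w
        exact ⟨(Θ.prod η).quotKerEquivRange (Submodule.Quotient.mk z), by simp⟩
    _ ≤ Module.finrank k (W₁ × W₂) := Submodule.finrank_le _
    _ = _ := Module.finrank_prod

end LinearAlgebra

section Bound

variable {k : Type*} [Field k] {a b n : ℕ}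

theorem LauForm.Kills.add {ω ω' : LauForm k a b n} (h : ω.Kills) (h' : ω'.Kills) :
    (ω + ω').Kills := fun v t ht => by
  rw [AlternatingMap.add_apply, h v t ht, h' v t ht, add_zero]

theorem LauForm.StdLE.smul {ω : LauForm k a b n} {ℓ : ℤ × ℤ →+ ℤ} {m : ℤ} (h : ω.StdLE ℓ m)
    (r : k) : (r • ω).StdLE ℓ m := fun u => Submodule.smul_mem _ r (h u)

theorem LauForm.stdLE_zero {ℓ : ℤ × ℤ →+ ℤ} {m : ℤ} : (0 : LauForm k a b n).StdLE ℓ m :=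
  fun _ => Submodule.zero_mem _

variable (k a b n) in
/-- The space of pairs of lifts. -/
def liftPairs : Submodule k (LauForm k a b (n + 1) × LauForm k a b (n + 1)) where
  carrier := {y | IsLiftPair y.1 y.2}
  add_mem' {y y'} h h' :=
    { kills := by
        rw [Prod.fst_add, Prod.snd_add, add_sub_add_comm]
        exact h.kills.add h'.kills
      right₀ := h.right₀.add h'.right₀
      left₀ := h.left₀.add h'.left₀
      right₁ := h.right₁.add h'.right₁
      left₁ := h.left₁.add h'.left₁
      bot₀ := h.bot₀.add h'.bot₀
      top₁ := h.top₁.add h'.top₁ }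
  zero_mem' :=
    { kills := fun v t _ => by simp
      right₀ := LauForm.stdLE_zero
      left₀ := LauForm.stdLE_zero
      right₁ := LauForm.stdLE_zero
      left₁ := LauForm.stdLE_zero
      bot₀ := LauForm.stdLE_zero
      top₁ := LauForm.stdLE_zero }
  smul_mem' r y h :=
    { kills := fun v t ht => by
        rw [Prod.smul_fst, Prod.smul_snd, ← smul_sub, AlternatingMap.smul_apply,
          h.kills v t ht, smul_zero]
      right₀ := h.right₀.smul r
      left₀ := h.left₀.smul r
      right₁ := h.right₁.smul r
      left₁ := h.left₁.smul r
      bot₀ := h.bot₀.smul r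
      top₁ := h.top₁.smul r }

variable (k a b n) in
/-- Contraction with the evaluation vector, as a `k`-linear map. -/
def contractEv : LauForm k a b (n + 1) →ₗ[k] LauForm k a b n where
  toFun y := y.curryLeft ev
  map_add' _ _ := rfl
  map_smul' _ _ := rfl

theorem finrank_Kp1_le (ha : 3 ≤ a) (hn : n + 2 = a * (b + 1)) {δ : KoszulMaps k a b}
    (hδ : IsKoszul k a b δ) :
    Module.finrank k (Kp1 k a b δ n) ≤
      (n + 1) * Nat.choose ((a + 1) * b) (n + 2) + (n + 1) := by
  obtain ⟨c, U, hcU⟩ := exists_critical_tests k a b (n + 2) (n + 1) ha hn rfl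
  refine (finrank_quotient_le_of_obstructions _
    (toForm k a b (n + 1) 1 ∘ₗ (LinearMap.ker (δ n 1)).subtype)
    (LinearMap.pi fun w => coeffAt (mixed k a b (U w) ∅) (-(c w : ℤ), 0) ∘ₗ topDiff ∘ₗ
      toForm k a b (n + 1) 1 ∘ₗ (LinearMap.ker (δ n 1)).subtype)
    (contractEv k a b (n + 1) ∘ₗ LinearMap.fst k _ _ ∘ₗ (liftPairs k a b (n + 1)).subtype)
    (vertCoeffs k a b (n + 1) ∘ₗ (LinearMap.snd k _ _ - LinearMap.fst k _ _) ∘ₗ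
      (liftPairs k a b (n + 1)).subtype) ?_ ?_).trans_eq ?_
  · intro z hz
    have hx := isCocycle_toForm hδ (LinearMap.mem_ker.mp z.2)
    obtain ⟨y₀, y₁, hy, he⟩ := exists_isLiftPair hx (hcU _ _ _ _ hx.edgePair (congrFun hz))
    exact ⟨⟨(y₀, y₁), hy⟩, he⟩
  · rintro z ⟨⟨y₀, y₁⟩, hy⟩ he h0
    obtain ⟨y, h1, h2, h3, h4, h5⟩ := IsLiftPair.exists_constant hy h0
    obtain ⟨z', rfl⟩ := exists_toForm_eq h1 h2 h3 h4
    refine ⟨z', toForm_injective ?_⟩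
    rw [toForm_koszul hδ, h5]
    exact he
  · rw [Module.finrank_fintype_fun_eq_card, Module.finrank_fintype_fun_eq_card]
    simp only [Fintype.card_prod, Fintype.card_fin, Fintype.card_coe, Finset.card_powersetCard,
      card_upper]
    ring

end Bound

/-- Let `3 ≤ a ≤ b` and set `p := ab + a − 1` (we write `p = n+1`).  Then
`κ_{p,1} ≤ p · C((a+1)b, p+1) + p` for the Segre–Veronese embedding of `ℙ¹×ℙ¹`
by `O(a)⊠O(b)`. -/
theorem segre_kappa_p1_le_at_ab_add_a_sub_one (k : Type*) [Field k] (a b : ℕ)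
    (ha : 3 ≤ a) (hab : a ≤ b)
    (δ : KoszulMaps k a b) (hδ : IsKoszul k a b δ)
    (p n : ℕ) (hp : p = a * b + a - 1) (hn : n + 1 = p) :
    Module.finrank k (Kp1 k a b δ n) ≤ p * Nat.choose ((a + 1) * b) (p + 1) + p := by
  subst hn
  exact finrank_Kp1_le ha (by rw [mul_add_one]; omega) hδ

end
end

section
/- For every integer p ≥ 1 one has κ_{p,1} ≥ p · C((a+1)b, p+1), where C denotes the binomial coefficient. (This lower bound comes from the syzygies of the rational normal scroll P^a × P^1 ⊂ P^{N−1} containing the Segre–Veronese surface.) -/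
open MvPolynomial
open scoped TensorProduct

set_option maxHeartbeats 1600000
set_option synthInstance.maxHeartbeats 400000
set_option maxSynthPendingDepth 3

noncomputable section

/-- The lexicographic position `α * (b + 1) + γ` in the monomial basis of `R_1` of `w` times the
`t`-th monomial of bidegree `(a, b - 1)`, where `t = α * b + γ`. -/
def scrollPos (b t : ℕ) : ℕ := t + t / b

/-- The exponent of the monomial of bidegree `(a, b)` at lexicographic position `s`. -/
def scrollExp (a b s : ℕ) : Fin 4 →₀ ℕ :=
  Finsupp.equivFunOnFinite.symm ![s / (b + 1), a - s / (b + 1), s % (b + 1), b - s % (b + 1)]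

theorem scrollPos_strictMono (b : ℕ) : StrictMono (scrollPos b) := fun _ _ h =>
  add_lt_add_of_lt_of_le h (Nat.div_le_div_right h.le)

theorem scrollPos_add_eq (b t e : ℕ) :
    scrollPos b t + e = (t % b + e) + (b + 1) * (t / b) := by
  have := Nat.div_add_mod t b
  unfold scrollPos
  linarith

theorem scrollPos_add_mod {b : ℕ} (hb : 0 < b) (t : ℕ) (e : Fin 2) :
    (scrollPos b t + e) % (b + 1) = t % b + e := by
  have := Nat.mod_lt t hb
  rw [scrollPos_add_eq, Nat.add_mul_mod_self_left, Nat.mod_eq_of_lt (by omega)]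

theorem scrollPos_add_div {b : ℕ} (hb : 0 < b) (t : ℕ) (e : Fin 2) :
    (scrollPos b t + e) / (b + 1) = t / b := by
  have := Nat.mod_lt t hb
  rw [scrollPos_add_eq, Nat.add_mul_div_left _ _ (by omega), Nat.div_eq_of_lt (by omega), zero_add]

theorem scrollExp_injective (a b : ℕ) : Function.Injective (scrollExp a b) := by
  intro s t h
  have h0 := DFunLike.congr_fun h 0
  have h2 := DFunLike.congr_fun h 2
  simp only [scrollExp, Finsupp.equivFunOnFinite_symm_apply_apply, Matrix.cons_val] at h0 h2
  rw [← Nat.div_add_mod s (b + 1), ← Nat.div_add_mod t (b + 1), h0, h2]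

/-- The `t`-th monomial of bidegree `(a, b - 1)`, multiplied by `w` if `e = 0` and by `z` if
`e = 1`, as an element of `R_1`. -/
def scrollVec (k : Type*) [Field k] {a b : ℕ} (hb : 0 < b) (t : Fin ((a + 1) * b)) (e : Fin 2) :
    RS k a b 1 :=
  ⟨monomial (scrollExp a b (scrollPos b t + e)) 1, by
    intro m hm
    obtain rfl := Finset.mem_singleton.mp (support_monomial_subset hm)
    have h1 := Nat.mod_lt t hb
    have h2 : (t : ℕ) / b < a + 1 := Nat.div_lt_of_lt_mul (t.2.trans_eq (mul_comm _ _))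
    simp only [scrollExp, Finsupp.equivFunOnFinite_symm_apply_apply, Matrix.cons_val,
      scrollPos_add_mod hb, scrollPos_add_div hb]
    omega⟩

/-- The two rows of the scroll have proportional columns: `(z u)(w u') = (w u)(z u')`. -/
theorem segMul_scrollVec_swap (k : Type*) [Field k] {a b : ℕ} (hb : 0 < b)
    (t t' : Fin ((a + 1) * b)) (e e' : Fin 2) :
    segMul k a b 1 (scrollVec k hb t e) (scrollVec k hb t' e') =
      segMul k a b 1 (scrollVec k hb t' e) (scrollVec k hb t e') := by
  apply Subtype.ext
  simp only [segMul, scrollVec, monomial_mul, mul_one]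
  refine congrArg (fun m => monomial m (1 : k)) (Finsupp.ext fun i => ?_)
  have h1 := Nat.mod_lt t hb
  have h2 := Nat.mod_lt t' hb
  fin_cases i <;>
    simp [scrollExp, scrollPos_add_mod hb, scrollPos_add_div hb] <;> omega

/-- The coefficient functional on `R_1` of the monomial at lexicographic position `s`. -/
def scrollCoord (k : Type*) [Field k] (a b s : ℕ) : RS k a b 1 →ₗ[k] k :=
  lcoeff k (scrollExp a b s) ∘ₗ (RS k a b 1).subtype

theorem scrollCoord_scrollVec (k : Type*) [Field k] {a b : ℕ} (hb : 0 < b)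
    (s : ℕ) (t : Fin ((a + 1) * b)) (e : Fin 2) :
    scrollCoord k a b s (scrollVec k hb t e) = if s = scrollPos b t + e then 1 else 0 := by
  simp only [scrollCoord, scrollVec, LinearMap.comp_apply, Submodule.subtype_apply, lcoeff_apply,
    coeff_monomial, (scrollExp_injective a b).eq_iff, eq_comm]

/-- The functional `v_1 ∧ ⋯ ∧ v_n ↦ det (c_r (v_s))` attached to functionals `c_1, …, c_n`. -/
def wedgeDet (k : Type*) [Field k] {M : Type*} [AddCommGroup M] [Module k M] (n : ℕ)
    (c : Fin n → M →ₗ[k] k) : ⋀[k]^n M →ₗ[k] k :=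
  exteriorPower.alternatingMapLinearEquiv (Matrix.detRowAlternating.compLinearMap (LinearMap.pi c))

theorem wedgeDet_wedge (k : Type*) [Field k] {M : Type*} [AddCommGroup M] [Module k M] (n : ℕ)
    (c : Fin n → M →ₗ[k] k) (v : Fin n → M) :
    wedgeDet k n c (wedge k n v) = (Matrix.of fun s r => c r (v s)).det :=
  exteriorPower.alternatingMapLinearEquiv_apply_ιMulti _ _

/-- The signed functional on `Λ^{n+1} V ⊗ V` reading off the coefficient in which the `i`-th of
the positions `P` is in the last tensor factor and the others are in the wedge. -/
def koszulCoeff (k : Type*) [Field k] (a b n : ℕ) (P : Fin (n + 2) → ℕ) (i : Fin (n + 2)) :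
    ((⋀[k]^(n + 1) (RS k a b 1)) ⊗[k] (RS k a b 1)) →ₗ[k] k :=
  (-1 : k) ^ (i : ℕ) • LinearMap.mul' k k ∘ₗ
    TensorProduct.map (wedgeDet k (n + 1) fun r => scrollCoord k a b (P (i.succAbove r)))
      (scrollCoord k a b (P i))

theorem koszulCoeff_wedge_tmul (k : Type*) [Field k] (a b n : ℕ) (P : Fin (n + 2) → ℕ)
    (i : Fin (n + 2)) (v : Fin (n + 1) → RS k a b 1) (f : RS k a b 1) :
    koszulCoeff k a b n P i (wedge k (n + 1) v ⊗ₜ[k] f) = (-1 : k) ^ (i : ℕ) *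
      ((Matrix.of fun s r => scrollCoord k a b (P (i.succAbove r)) (v s)).det *
        scrollCoord k a b (P i) f) := by
  simp [koszulCoeff, wedgeDet_wedge]

theorem eq_C_of_mem_Bihom_zero {k : Type*} [Field k] {f : MvPolynomial (Fin 4) k}
    (hf : f ∈ Bihom k 0 0) : f = C (coeff 0 f) := by
  ext m
  rw [coeff_C]
  split_ifs with h
  · rw [h]
  · by_contra hm
    obtain ⟨h1, h2⟩ := hf m (mem_support_iff.mpr hm)
    apply h
    ext i
    fin_cases i <;> simp <;> omega

theorem segMul_zero_right (k : Type*) [Field k] (a b : ℕ) (v : RS k a b 1) (f : RS k a b 0) :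
    segMul k a b 0 v f = coeff 0 (f : MvPolynomial (Fin 4) k) • v := by
  apply Subtype.ext
  have hf : (f : MvPolynomial (Fin 4) k) ∈ Bihom k 0 0 := by
    simpa only [RS, zero_mul] using f.2
  have h := eq_C_of_mem_Bihom_zero hf
  simp only [segMul, SetLike.val_smul]
  rw [h, coeff_C, if_pos rfl, smul_eq_C_mul, mul_comm]

/-- Tensors `v_1 ∧ ⋯ ∧ v_n ⊗ f` are enough to determine a linear map. -/
theorem linearMap_ext_wedge_tmul {k : Type*} [Field k] {M N Q : Type*} [AddCommGroup M]
    [Module k M] [AddCommGroup N] [Module k N] [AddCommGroup Q] [Module k Q] {n : ℕ}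
    {F G : ((⋀[k]^n M) ⊗[k] N) →ₗ[k] Q}
    (h : ∀ (v : Fin n → M) (f : N), F (wedge k n v ⊗ₜ f) = G (wedge k n v ⊗ₜ f)) : F = G := by
  apply TensorProduct.ext
  apply exteriorPower.linearMap_ext
  ext v f
  exact h v f

/-- On boundaries, all the functionals `koszulCoeff k a b n P i` are the same determinant, by
Laplace expansion. -/
theorem koszulCoeff_boundary (k : Type*) [Field k] (a b : ℕ) (δ : KoszulMaps k a b)
    (hδ : IsKoszul k a b δ) (n : ℕ) (P : Fin (n + 2) → ℕ) (i j : Fin (n + 2)) :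
    koszulCoeff k a b n P i ∘ₗ δ (n + 1) 0 = koszulCoeff k a b n P j ∘ₗ δ (n + 1) 0 := by
  have key : ∀ (i : Fin (n + 2)) (v : Fin (n + 2) → RS k a b 1) (f : RS k a b 0),
      koszulCoeff k a b n P i (δ (n + 1) 0 (wedge k (n + 2) v ⊗ₜ f)) =
        coeff 0 (f : MvPolynomial (Fin 4) k) *
          (Matrix.of fun r s => scrollCoord k a b (P r) (v s)).det := by
    intro i v f
    rw [hδ, map_sum, Matrix.det_succ_row _ i, Finset.mul_sum]
    refine Finset.sum_congr rfl fun s _ => ?_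
    rw [map_smul, segMul_zero_right]
    erw [koszulCoeff_wedge_tmul]
    rw [map_smul, ← Matrix.det_transpose, pow_add]
    simp only [smul_eq_mul, Matrix.of_apply]
    have : (Matrix.of fun s' r => scrollCoord k a b (P (i.succAbove r))
        (v (s.succAbove s'))).transpose =
      (Matrix.of fun r s => scrollCoord k a b (P r) (v s)).submatrix i.succAbove s.succAbove := rfl
    rw [this]
    ring
  apply linearMap_ext_wedge_tmul
  intro v f
  rw [LinearMap.comp_apply, LinearMap.comp_apply, key, key]

/-- A determinant of Kronecker deltas between a strictly increasing and a weakly increasing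
sequence, each with one entry split off. -/
theorem det_delta_mul_delta {k : Type*} [Field k] {n : ℕ} {P L : Fin (n + 1) → ℕ}
    (hP : StrictMono P) (hL : Monotone L) (i j : Fin (n + 1)) :
    (Matrix.of fun s r => if P (i.succAbove r) = L (j.succAbove s) then (1 : k) else 0).det *
      (if P i = L j then 1 else 0) = if P = L ∧ i = j then 1 else 0 := by
  split_ifs with h1 h2 h2
  · obtain ⟨rfl, rfl⟩ := h2
    have : (Matrix.of fun s r => if P (i.succAbove r) = P (i.succAbove s) then (1 : k) else 0) =
        1 := by
      ext s r
      simp [Matrix.one_apply, hP.injective.eq_iff, eq_comm]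
    rw [this, Matrix.det_one, mul_one]
  · rw [mul_one]
    by_contra hdet
    rw [Matrix.det_apply] at hdet
    obtain ⟨τ, -, hτ⟩ := Finset.exists_ne_zero_of_sum_ne_zero hdet
    have hprod : ∀ s, P (i.succAbove s) = L (j.succAbove (τ s)) := by
      intro s
      by_contra hs
      apply hτ
      rw [Finset.prod_eq_zero (Finset.mem_univ s) (by simp [hs]), smul_zero]
    let π : Equiv.Perm (Fin (n + 1)) :=
      (finSuccEquiv' j).trans ((Equiv.optionCongr τ.symm).trans (finSuccEquiv' i).symm)
    have hπ : P ∘ π = L := by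
      funext x
      rcases eq_or_ne x j with rfl | hx
      · simp only [Function.comp_apply, π, Equiv.trans_apply, finSuccEquiv'_at,
          Equiv.optionCongr_apply, Option.map_none, finSuccEquiv'_symm_none, h1]
      · obtain ⟨y, rfl⟩ := Fin.exists_succAbove_eq hx
        simp only [Function.comp_apply, π, Equiv.trans_apply, finSuccEquiv'_succAbove,
          Equiv.optionCongr_apply, Option.map_some, finSuccEquiv'_symm_some, hprod,
          Equiv.apply_symm_apply]
    have hPL : P = L := by
      have := Tuple.unique_monotone (f := P) (σ := π) (τ := 1) (by rw [hπ]; exact hL)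
        (by simpa using hP.monotone)
      rw [hπ] at this
      simpa using this.symm
    exact h2 ⟨hPL, hP.injective (by rw [h1, hPL])⟩
  · obtain ⟨rfl, rfl⟩ := h2
    exact absurd rfl h1
  · rw [mul_zero]

/-- The coefficient of `t^m` in the Koszul cycle
`∑ i, (-1)^i ⋀_{j ≠ i} (w + t z) u_{I j} ⊗ w u_{I i}` supported on the scroll. -/
def scrollCycle (k : Type*) [Field k] {a b : ℕ} (hb : 0 < b) (n : ℕ)
    (I : Fin (n + 2) → Fin ((a + 1) * b)) (m : ℕ) :
    (⋀[k]^(n + 1) (RS k a b 1)) ⊗[k] (RS k a b 1) :=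
  ∑ σ : Fin (n + 2) → Fin 2 with ∑ j, (σ j : ℕ) = m, ∑ i with σ i = 0,
    (-1 : k) ^ (i : ℕ) • (wedge k (n + 1)
      (fun j => scrollVec k hb (I (i.succAbove j)) (σ (i.succAbove j))) ⊗ₜ[k]
        scrollVec k hb (I i) (σ i))

/-- The scroll elements are Koszul cycles: exchanging the two factors that are multiplied together
reverses the sign. -/
theorem scrollCycle_mem_ker (k : Type*) [Field k] {a b : ℕ} (hb : 0 < b) (δ : KoszulMaps k a b)
    (hδ : IsKoszul k a b δ) (n : ℕ) (I : Fin (n + 2) → Fin ((a + 1) * b)) (m : ℕ) :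
    δ n 1 (scrollCycle k hb n I m) = 0 := by
  have expand : δ n 1 (scrollCycle k hb n I m) =
      ∑ x ∈ Finset.univ.filter (fun x : (Fin (n + 2) → Fin 2) × Fin (n + 2) × Fin (n + 1) =>
          ∑ j, (x.1 j : ℕ) = m ∧ x.1 x.2.1 = 0),
        (-1 : k) ^ (x.2.1 + x.2.2 : ℕ) • (wedge k n (fun l =>
          scrollVec k hb (I (x.2.1.succAbove (x.2.2.succAbove l)))
            (x.1 (x.2.1.succAbove (x.2.2.succAbove l)))) ⊗ₜ[k]
          segMul k a b 1 (scrollVec k hb (I (x.2.1.succAbove x.2.2)) (x.1 (x.2.1.succAbove x.2.2)))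
            (scrollVec k hb (I x.2.1) (x.1 x.2.1))) := by
    rw [scrollCycle, map_sum]
    simp only [map_sum, map_smul]
    simp only [Finset.sum_filter, ← Finset.univ_product_univ, Finset.sum_product]
    refine Finset.sum_congr rfl fun σ _ => ?_
    split_ifs with h1
    · refine Finset.sum_congr rfl fun i _ => ?_
      by_cases h2 : σ i = 0
      · simp only [if_pos h2, if_pos (And.intro h1 h2)]
        rw [hδ, Finset.smul_sum]
        refine Finset.sum_congr rfl fun j _ => ?_
        rw [smul_smul, pow_add]
      · simp [h2]
    · simp [h1]
  rw [expand]
  refine Finset.sum_involution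
    (fun x _ => (x.1 ∘ Equiv.swap x.2.1 (x.2.1.succAbove x.2.2),
      x.2.1.succAbove x.2.2, x.2.2.predAbove x.2.1)) ?_ ?_ ?_ ?_
  · rintro ⟨σ, i, j⟩ hx
    have hne : ∀ l, Equiv.swap i (i.succAbove j) (i.succAbove (j.succAbove l)) =
        i.succAbove (j.succAbove l) := fun l =>
      Equiv.swap_apply_of_ne_of_ne (Fin.succAbove_ne _ _)
        (Fin.succAbove_right_injective.ne (Fin.succAbove_ne _ _))
    simp only [Fin.succAbove_succAbove_succAbove_predAbove, Fin.succAbove_succAbove_predAbove,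
      Function.comp_apply, hne, Equiv.swap_apply_left, Equiv.swap_apply_right,
      Fin.neg_one_pow_succAbove_add_predAbove]
    rw [segMul_scrollVec_swap k hb (I i), neg_smul, add_neg_cancel]
  · rintro ⟨σ, i, j⟩ hx _ h
    exact Fin.succAbove_ne i j (congrArg (fun y => y.2.1) h)
  · rintro ⟨σ, i, j⟩ hx
    simp only [Finset.mem_filter, Finset.mem_univ, true_and] at hx ⊢
    refine ⟨?_, by simp [hx.2]⟩
    rw [← hx.1]
    exact Equiv.sum_comp (Equiv.swap i (i.succAbove j)) fun l => (σ l : ℕ)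
  · rintro ⟨σ, i, j⟩ hx
    simp only [Fin.succAbove_succAbove_predAbove, Fin.predAbove_predAbove_succAbove]
    refine Prod.ext ?_ rfl
    funext l
    simp [Equiv.swap_comm (i.succAbove j) i]

theorem scrollPos_add_monotone {b n : ℕ} {N : ℕ} {I : Fin n → Fin N} (hI : StrictMono I)
    (σ : Fin n → Fin 2) : Monotone fun j => scrollPos b (I j) + σ j := by
  intro i j hij
  rcases hij.eq_or_lt with rfl | h
  · rfl
  · have := scrollPos_strictMono b (Fin.lt_def.mp (hI h))
    dsimp only
    omega

theorem koszulCoeff_scrollCycle (k : Type*) [Field k] {a b : ℕ} (hb : 0 < b) (n : ℕ)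
    {P : Fin (n + 2) → ℕ} (hP : StrictMono P) (i : Fin (n + 2))
    {I : Fin (n + 2) → Fin ((a + 1) * b)} (hI : StrictMono I) (m : ℕ) :
    koszulCoeff k a b n P i (scrollCycle k hb n I m) =
      ∑ σ : Fin (n + 2) → Fin 2 with ∑ j, (σ j : ℕ) = m,
        if P = (fun j => scrollPos b (I j) + σ j) ∧ σ i = 0 then 1 else 0 := by
  rw [scrollCycle, map_sum]
  refine Finset.sum_congr rfl fun σ _ => ?_
  have h : ∀ j : Fin (n + 2), koszulCoeff k a b n P i ((-1 : k) ^ (j : ℕ) • (wedge k (n + 1)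
      (fun l => scrollVec k hb (I (j.succAbove l)) (σ (j.succAbove l))) ⊗ₜ[k]
        scrollVec k hb (I j) (σ j))) =
      if j = i then (if P = (fun j => scrollPos b (I j) + σ j) then 1 else 0) else 0 := by
    intro j
    rw [map_smul, koszulCoeff_wedge_tmul]
    simp only [scrollCoord_scrollVec]
    rw [det_delta_mul_delta hP (scrollPos_add_monotone (b := b) hI σ) i j]
    split_ifs with h1 h2 h3 h2 h3
    · simp [h2, ← mul_pow]
    · exact absurd h1.1 h3
    · exact absurd h1.2.symm h2
    · exact absurd ⟨h3, h2.symm⟩ h1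
    · simp
    · simp
  rw [map_sum, Finset.sum_congr rfl fun j _ => h j, Finset.sum_ite_eq']
  simp only [Finset.mem_filter, Finset.mem_univ, true_and]
  split_ifs <;> tauto

/-- The indicator of the indices greater than `d`. -/
def tailInd (n : ℕ) (d : Fin (n + 1)) (i : Fin (n + 2)) : Fin 2 := if d.castSucc < i then 1 else 0

/-- The positions of the leading term of the scroll cycle `scrollCycle k hb n I (n + 1 - d)`. -/
def leadPos (b n : ℕ) {N : ℕ} (I : Fin (n + 2) → Fin N) (d : Fin (n + 1)) (j : Fin (n + 2)) : ℕ :=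
  scrollPos b (I j) + tailInd n d j

theorem leadPos_strictMono (b n : ℕ) {N : ℕ} {I : Fin (n + 2) → Fin N} (hI : StrictMono I)
    (d : Fin (n + 1)) : StrictMono (leadPos b n I d) := by
  intro i j hij
  have := scrollPos_strictMono b (Fin.lt_def.mp (hI hij))
  have h : tailInd n d i ≤ tailInd n d j := by
    unfold tailInd
    split_ifs with h1 h2
    · rfl
    · exact absurd (h1.trans hij) h2
    · exact Fin.zero_le _
    · rfl
  have h' : (tailInd n d i : ℕ) ≤ tailInd n d j := h
  unfold leadPos
  omega

/-- Among 0-1 sequences with a given sum, `tailInd n d` is the only one maximizing the first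
moment. -/
theorem moment_le_tailInd (n : ℕ) (d : Fin (n + 1)) (σ : Fin (n + 2) → Fin 2)
    (hσ : ∑ j, (σ j : ℕ) = ∑ j, (tailInd n d j : ℕ)) :
    σ = tailInd n d ∨ ∑ j : Fin (n + 2), (j : ℕ) * (σ j : ℕ) <
      ∑ j : Fin (n + 2), (j : ℕ) * (tailInd n d j : ℕ) := by
  by_cases h : σ = tailInd n d
  · exact Or.inl h
  right
  obtain ⟨j, hj⟩ := Function.ne_iff.mp h
  have hterm : ∀ i : Fin (n + 2), σ i ≠ tailInd n d i →
      0 < (2 * (i : ℤ) - (2 * (d : ℤ) + 1)) * ((tailInd n d i : ℕ) - (σ i : ℕ) : ℤ) := by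
    intro i hi
    have hlt := (σ i).2
    have hne : (σ i : ℕ) ≠ tailInd n d i := fun h => hi (Fin.ext h)
    by_cases hdi : d.castSucc < i
    · have hdi' : (d : ℕ) < i := hdi
      have h1 : (tailInd n d i : ℕ) = 1 := by simp [tailInd, hdi]
      have h0 : (σ i : ℕ) = 0 := by omega
      rw [h1, h0]
      push_cast
      omega
    · have hdi' : (i : ℕ) ≤ d := not_lt.mp hdi
      have h1 : (tailInd n d i : ℕ) = 0 := by simp [tailInd, hdi]
      have h0 : (σ i : ℕ) = 1 := by omega
      rw [h1, h0]
      push_cast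
      omega
  have hpos : 0 < ∑ i : Fin (n + 2),
      (2 * (i : ℤ) - (2 * (d : ℤ) + 1)) * ((tailInd n d i : ℕ) - (σ i : ℕ) : ℤ) := by
    refine Finset.sum_pos' (fun i _ => ?_) ⟨j, Finset.mem_univ j, hterm j hj⟩
    by_cases hi : σ i = tailInd n d i
    · simp [hi]
    · exact (hterm i hi).le
  have hσ' : ∑ j, ((σ j : ℕ) : ℤ) = ∑ j, ((tailInd n d j : ℕ) : ℤ) := by exact_mod_cast hσ
  have hsplit : ∑ i : Fin (n + 2),
      (2 * (i : ℤ) - (2 * (d : ℤ) + 1)) * ((tailInd n d i : ℕ) - (σ i : ℕ) : ℤ) =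
      2 * (∑ i : Fin (n + 2), (i : ℤ) * (tailInd n d i : ℕ) -
          ∑ i : Fin (n + 2), (i : ℤ) * (σ i : ℕ)) -
        (2 * (d : ℤ) + 1) * (∑ i, ((tailInd n d i : ℕ) : ℤ) - ∑ i, ((σ i : ℕ) : ℤ)) := by
    rw [← Finset.sum_sub_distrib, ← Finset.sum_sub_distrib, Finset.mul_sum, Finset.mul_sum,
      ← Finset.sum_sub_distrib]
    refine Finset.sum_congr rfl fun i _ => ?_
    ring
  rw [hsplit, hσ', sub_self, mul_zero, sub_zero] at hpos
  zify
  linarith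

/-- A family that is triangular with respect to some functionals is linearly independent. -/
theorem linearIndependent_of_triangular {k M ι κ : Type*} [Field k] [AddCommGroup M] [Module k M]
    [LinearOrder κ] (E : ι → M) (φ : ι → M →ₗ[k] k) (key : ι → κ)
    (hdiag : ∀ x, φ x (E x) ≠ 0) (htri : ∀ x y, φ x (E y) ≠ 0 → y = x ∨ key x < key y) :
    LinearIndependent k E := by
  classical
  rw [linearIndependent_iff']
  intro s c hc
  by_contra! hne
  obtain ⟨i, his, hi⟩ := hne
  obtain ⟨x, hx, hmax⟩ := Finset.exists_max_image (s.filter fun i => c i ≠ 0) key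
    ⟨i, Finset.mem_filter.mpr ⟨his, hi⟩⟩
  rw [Finset.mem_filter] at hx
  have h := congrArg (φ x) hc
  rw [map_sum, map_zero, Finset.sum_eq_single_of_mem x hx.1] at h
  · rw [map_smul, smul_eq_mul] at h
    exact (mul_ne_zero hx.2 (hdiag x)) h
  · intro y hy hyx
    rw [map_smul, smul_eq_mul]
    by_contra hmul
    have hy0 := left_ne_zero_of_mul hmul
    rcases htri x y (right_ne_zero_of_mul hmul) with h' | h'
    · exact hyx h'
    · exact absurd (hmax y (Finset.mem_filter.mpr ⟨hy, hy0⟩)) (not_le.mpr h')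

theorem Bihom_finite (k : Type*) [Field k] (d e : ℕ) : Module.Finite k (Bihom k d e) := by
  have h : Bihom k d e ≤ restrictTotalDegree (Fin 4) k (d + e) := by
    intro f hf
    rw [mem_restrictTotalDegree]
    refine Finset.sup_le fun m hm => ?_
    obtain ⟨h1, h2⟩ := hf m hm
    rw [Finsupp.sum_fintype _ _ fun _ => rfl, Fin.sum_univ_four]
    omega
  exact Module.Finite.of_injective _ (Submodule.inclusion_injective h)

/-- The functional detecting the leading term of a scroll cycle; it vanishes on boundaries. -/
def leadFunctional (k : Type*) [Field k] (a b n : ℕ) {N : ℕ} (I : Fin (n + 2) → Fin N)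
    (d : Fin (n + 1)) : ((⋀[k]^(n + 1) (RS k a b 1)) ⊗[k] (RS k a b 1)) →ₗ[k] k :=
  koszulCoeff k a b n (leadPos b n I d) d.castSucc -
    koszulCoeff k a b n (leadPos b n I d) (Fin.last (n + 1))

theorem leadFunctional_scrollCycle (k : Type*) [Field k] {a b : ℕ} (hb : 0 < b) (n : ℕ)
    {I J : Fin (n + 2) → Fin ((a + 1) * b)} (hI : StrictMono I) (hJ : StrictMono J)
    (d : Fin (n + 1)) (m : ℕ) :
    leadFunctional k a b n I d (scrollCycle k hb n J m) =
      ∑ σ : Fin (n + 2) → Fin 2 with ∑ j, (σ j : ℕ) = m,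
        if leadPos b n I d = (fun j => scrollPos b (J j) + σ j) then
          (if σ d.castSucc = 0 then 1 else 0) - (if σ (Fin.last (n + 1)) = 0 then 1 else 0)
        else 0 := by
  rw [leadFunctional, LinearMap.sub_apply,
    koszulCoeff_scrollCycle k hb n (leadPos_strictMono b n hI d) _ hJ,
    koszulCoeff_scrollCycle k hb n (leadPos_strictMono b n hI d) _ hJ, ← Finset.sum_sub_distrib]
  refine Finset.sum_congr rfl fun σ _ => ?_
  split_ifs <;> simp_all

theorem tailInd_castSucc (n : ℕ) (d d' : Fin (n + 1)) :
    tailInd n d' d.castSucc = 0 ↔ d ≤ d' := by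
  simp [tailInd]

theorem tailInd_last (n : ℕ) (d : Fin (n + 1)) : tailInd n d (Fin.last (n + 1)) = 1 := by
  simp [tailInd, Fin.castSucc_lt_last]

theorem leadFunctional_scrollCycle_self (k : Type*) [Field k] {a b : ℕ} (hb : 0 < b) (n : ℕ)
    {I : Fin (n + 2) → Fin ((a + 1) * b)} (hI : StrictMono I) (d : Fin (n + 1)) :
    leadFunctional k a b n I d (scrollCycle k hb n I (∑ j, (tailInd n d j : ℕ))) = 1 := by
  rw [leadFunctional_scrollCycle k hb n hI hI, Finset.sum_eq_single_of_mem (tailInd n d)]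
  · rw [if_pos (by rfl), if_pos ((tailInd_castSucc n d d).mpr le_rfl), tailInd_last]
    simp
  · simp
  · intro σ _ hσ
    refine if_neg fun h => hσ ?_
    funext j
    have := congrFun h j
    simp only [leadPos] at this
    exact Fin.ext (by omega)

theorem leadFunctional_scrollCycle_ne_zero (k : Type*) [Field k] {a b : ℕ} (hb : 0 < b) (n : ℕ)
    {I J : Fin (n + 2) → Fin ((a + 1) * b)} (hI : StrictMono I) (hJ : StrictMono J)
    (d e : Fin (n + 1))
    (h : leadFunctional k a b n I d (scrollCycle k hb n J (∑ j, (tailInd n e j : ℕ))) ≠ 0) :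
    (J = I ∧ e = d) ∨
      toLex (∑ j : Fin (n + 2), (j : ℕ) * leadPos b n I d j, d) <
        toLex (∑ j : Fin (n + 2), (j : ℕ) * leadPos b n J e j, e) := by
  rw [leadFunctional_scrollCycle k hb n hI hJ] at h
  obtain ⟨σ, hσ, hne⟩ := Finset.exists_ne_zero_of_sum_ne_zero h
  rw [Finset.mem_filter] at hσ
  rw [ite_ne_right_iff] at hne
  obtain ⟨hlead, hval⟩ := hne
  rcases moment_le_tailInd n e σ hσ.2 with rfl | hlt
  · have hde : d ≤ e := by
      by_contra hde
      rw [if_neg (fun h0 => hde ((tailInd_castSucc n d e).mp h0)), tailInd_last] at hval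
      simp at hval
    rcases hde.eq_or_lt with rfl | hlt
    · left
      refine ⟨?_, rfl⟩
      funext j
      have := congrFun hlead j
      simp only [leadPos] at this
      exact Fin.ext ((scrollPos_strictMono b).injective (by omega))
    · right
      rw [Prod.Lex.toLex_lt_toLex]
      exact Or.inr ⟨by rw [hlead]; rfl, hlt⟩
  · right
    rw [Prod.Lex.toLex_lt_toLex]
    left
    simp only [hlead]
    simp only [leadPos, mul_add, Finset.sum_add_distrib]
    omega

/-- For every `p ≥ 1` (we write `p = n+1`) one has
`κ_{p,1} ≥ p · C((a+1)b, p+1)`, the lower bound coming from the syzygies of the rational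
normal scroll `ℙ^a × ℙ¹` containing the Segre–Veronese surface (`1 ≤ a ≤ b`). -/
theorem segre_kappa_p1_ge_scroll_a (k : Type*) [Field k] (a b : ℕ)
    (ha : 1 ≤ a) (hab : a ≤ b)
    (δ : KoszulMaps k a b) (hδ : IsKoszul k a b δ) (n : ℕ) :
    (n + 1) * Nat.choose ((a + 1) * b) (n + 2) ≤ Module.finrank k (Kp1 k a b δ n) := by
  have hb : 0 < b := by omega
  have := Bihom_finite k (1 * a) (1 * b)
  let ι := Fin (n + 1) × Set.powersetCard (Fin ((a + 1) * b)) (n + 2)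
  let I : ι → Fin (n + 2) → Fin ((a + 1) * b) := fun x => x.2.1.orderEmbOfFin x.2.2
  have hI : ∀ x, StrictMono (I x) := fun x => (x.2.1.orderEmbOfFin x.2.2).strictMono
  have hI_inj : ∀ x y : ι, I x = I y → x.2 = y.2 := by
    intro x y h
    apply Subtype.ext
    apply Finset.coe_injective
    rw [← Finset.range_orderEmbOfFin x.2.1 x.2.2, ← Finset.range_orderEmbOfFin y.2.1 y.2.2]
    exact congrArg Set.range h
  let E : ι → Kp1 k a b δ n := fun x => Submodule.Quotient.mk
    ⟨scrollCycle k hb n (I x) (∑ j, (tailInd n x.1 j : ℕ)),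
      LinearMap.mem_ker.mpr (scrollCycle_mem_ker k hb δ hδ n (I x) _)⟩
  let φ : ι → Kp1 k a b δ n →ₗ[k] k := fun x => Submodule.liftQ _
    (leadFunctional k a b n (I x) x.1 ∘ₗ (LinearMap.ker (δ n 1)).subtype) (by
      rintro ⟨y, hy⟩ ⟨z, hz⟩
      rw [LinearMap.mem_ker, LinearMap.comp_apply, ← hz]
      exact sub_eq_zero.mpr (LinearMap.congr_fun (koszulCoeff_boundary k a b δ hδ n _ _ _) z))
  have hE : LinearIndependent k E := by
    refine linearIndependent_of_triangular E φ (fun x : ι =>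
      toLex (∑ j : Fin (n + 2), (j : ℕ) * leadPos b n (I x) x.1 j, x.1)) ?_ ?_
    · intro x
      have h : φ x (E x) = 1 := leadFunctional_scrollCycle_self k hb n (hI x) x.1
      rw [h]
      exact one_ne_zero
    · intro x y hxy
      refine (leadFunctional_scrollCycle_ne_zero k hb n (hI x) (hI y) x.1 y.1 hxy).imp_left ?_
      rintro ⟨h1, h2⟩
      exact Prod.ext h2 (hI_inj _ _ h1)
  have hcard := hE.fintype_card_le_finrank
  rwa [Fintype.card_prod, Fintype.card_fin, Fintype.card_eq_nat_card (α := Set.powersetCard _ _),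
    Set.powersetCard.card, Nat.card_fin] at hcard

end
end
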